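/- arXiv:1909.04284 — 2 statements merged into one kernel-verified Lean document; each statement's English description precedes it below -/
import Mathlib

section
/- Let p ≥ 3 be a prime, let q, k ≥ 1 be natural numbers and θ ∈ ℚ_p with θ ≠ 1, |q|_p < |k|_p, |θ − 1|_p < |q|_p², and suppose gcd(k, p − 1) = 1. Then there exists x_* ∈ ℚ_p with x_* ≠ 1 and f(x_*) = x_*, and the Julia set is this single point: ⋂_{n≥1} f^{−n}(X) = {x_*}. -/
open scoped Classical

/-- The Potts–Bethe mapping on `ℚ_[p]` (with total division, so defined everywhere). -/
noncomputable def pottsBethe (p : ℕ) [Fact p.Prime] (q k : ℕ) (θ : ℚ_[p]) : ℚ_[p] → ℚ_[p] :=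
  fun x => ((θ * x + (q : ℚ_[p]) - 1) / (x + θ + (q : ℚ_[p]) - 2)) ^ k

/-- The center `x_ξ` associated with a `k`-th root of unity `ξ`. -/
noncomputable def xiCenter (p : ℕ) [Fact p.Prime] (q k : ℕ) (θ ξ : ℚ_[p]) : ℚ_[p] :=
  if ξ = 1 then
    1 - (q : ℚ_[p]) + ((k : ℚ_[p]) - 1) *
      (1 - (q : ℚ_[p]) / 2 + ((k : ℚ_[p]) - 2) * (q : ℚ_[p]) ^ 2 / (6 * (k : ℚ_[p]))) * (θ - 1)
  else
    2 - (q : ℚ_[p]) - θ + (q : ℚ_[p]) * (θ - 1) / (1 - ξ)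

/-- The union `X` of the balls of radius `r = ‖q (θ - 1)‖` around the centers `x_ξ`. -/
def XSet (p : ℕ) [Fact p.Prime] (q k : ℕ) (θ : ℚ_[p]) : Set ℚ_[p] :=
  {x : ℚ_[p] | ∃ ξ : ℚ_[p], ξ ^ k = 1 ∧ ‖x - xiCenter p q k θ ξ‖ < ‖(q : ℚ_[p]) * (θ - 1)‖}

/-- The Julia set `J = ⋂_{n ≥ 1} f^{-n}(X)`. -/
noncomputable def JSet (p : ℕ) [Fact p.Prime] (q k : ℕ) (θ : ℚ_[p]) : Set ℚ_[p] :=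
  ⋂ n ∈ Set.Ici 1, (pottsBethe p q k θ)^[n] ⁻¹' XSet p q k θ

theorem aux_disc {p : ℕ} [Fact p.Prime] {x y : ℚ_[p]} (h : ‖x‖ < ‖y‖) : ‖x‖ ≤ ‖y‖ / p := by
  have hy : y ≠ 0 := by
    rintro rfl
    simp at h
    exact absurd h (not_lt.mpr (norm_nonneg x))
  have hy0 : 0 < ‖y‖ := norm_pos_iff.mpr hy
  have h1 : ‖x / y‖ < (p : ℝ) ^ (0 : ℤ) := by
    rw [norm_div, zpow_zero, div_lt_one hy0]; exact h
  rw [Padic.norm_lt_pow_iff_norm_le_pow_sub_one, norm_div, div_le_iff₀ hy0] at h1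
  calc ‖x‖ ≤ _ := h1
    _ = ‖y‖ / p := by rw [zero_sub, zpow_neg_one]; ring

theorem aux_natnorm {p : ℕ} [hpf : Fact p.Prime] (j : ℕ) (hj : 1 ≤ j) :
    (1 : ℝ) / j ≤ ‖(j : ℚ_[p])‖ := by
  have hj0 : (j : ℚ_[p]) ≠ 0 := by exact_mod_cast (by omega : j ≠ 0)
  have hp0 : 0 < (p : ℝ) := by exact_mod_cast hpf.out.pos
  rw [Padic.norm_eq_zpow_neg_valuation hj0, Padic.valuation_natCast, zpow_neg, zpow_natCast,
    ← one_div]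
  apply one_div_le_one_div_of_le (by positivity)
  have := Nat.le_of_dvd (by omega) (pow_padicValNat_dvd (p := p) (n := j))
  exact_mod_cast this

theorem aux_wpow {p : ℕ} [hpf : Fact p.Prime] (hp : 3 ≤ p) {w : ℚ_[p]} (hw : ‖w‖ < 1) (m j : ℕ)
    (hj : 1 ≤ j) (h : j < 3 ^ m) : ‖w ^ m‖ < ‖(j : ℚ_[p])‖ := by
  have hp3 : (3 : ℝ) ≤ p := by exact_mod_cast hp
  have hw' : ‖w‖ ≤ 1 / p := by
    have := aux_disc (x := w) (y := (1 : ℚ_[p])) (by simpa using hw)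
    simpa using this
  have hw3 : ‖w‖ ≤ 1 / 3 := hw'.trans (one_div_le_one_div_of_le (by norm_num) hp3)
  refine lt_of_lt_of_le ?_ (aux_natnorm j hj)
  rw [norm_pow]
  have h3 : (j : ℝ) < 3 ^ m := by exact_mod_cast h
  have hj0 : (0 : ℝ) < j := by exact_mod_cast hj
  calc ‖w‖ ^ m ≤ (1 / 3) ^ m := by gcongr
    _ = 1 / 3 ^ m := by rw [one_div_pow]
    _ < 1 / j := one_div_lt_one_div_of_lt hj0 h3

theorem aux_nat_le {p : ℕ} [Fact p.Prime] (n : ℕ) : ‖(n : ℚ_[p])‖ ≤ 1 := by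
  simpa using Padic.norm_int_le_one (p := p) (n : ℤ)

theorem aux_term {p : ℕ} [hpf : Fact p.Prime] (hp : 3 ≤ p) {w : ℚ_[p]} (hw : ‖w‖ < 1)
    (k m n j : ℕ) (h : j + 1 < 3 ^ m) :
    ‖(k.choose (j + 1) : ℚ_[p]) * w ^ (m + n)‖ ≤ ‖(k : ℚ_[p])‖ * ‖w‖ ^ n / p := by
  have h1 := aux_disc (aux_wpow hp hw m (j + 1) (by omega) h)
  have h2 : ‖((j + 1 : ℕ) : ℚ_[p])‖ * ‖(k.choose (j + 1) : ℚ_[p])‖ ≤ ‖(k : ℚ_[p])‖ := by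
    rcases k with _ | k
    · simp
    · have := Nat.add_one_mul_choose_eq k j
      rw [← norm_mul, ← Nat.cast_mul, mul_comm, ← this, Nat.cast_mul, norm_mul]
      exact mul_le_of_le_one_right (norm_nonneg _) (aux_nat_le _)
  have hp0 : 0 < (p : ℝ) := by exact_mod_cast hpf.out.pos
  rw [pow_add, norm_mul, norm_mul, norm_pow w n]
  calc ‖(k.choose (j + 1) : ℚ_[p])‖ * (‖w ^ m‖ * ‖w‖ ^ n)
      ≤ ‖(k.choose (j + 1) : ℚ_[p])‖ * (‖((j + 1 : ℕ) : ℚ_[p])‖ / p * ‖w‖ ^ n) := by gcongr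
    _ = (‖((j + 1 : ℕ) : ℚ_[p])‖ * ‖(k.choose (j + 1) : ℚ_[p])‖) * ‖w‖ ^ n / p := by ring
    _ ≤ _ := by gcongr

theorem aux_three (m : ℕ) : m + 2 < 3 ^ (m + 1) := by
  induction m with
  | zero => norm_num
  | succ n ih => rw [pow_succ]; omega

theorem aux_three' (m : ℕ) : m + 4 < 3 ^ (m + 2) := by
  induction m with
  | zero => norm_num
  | succ n ih => rw [pow_succ]; omega

theorem aux_binom {p : ℕ} [Fact p.Prime] (w v : ℚ_[p]) (k : ℕ) (hk : 1 ≤ k) :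
    (w + v) ^ k - v ^ k - k * w * v ^ (k - 1) =
      ∑ j ∈ Finset.range (k - 1), w ^ (j + 2) * v ^ (k - (j + 2)) * (k.choose (j + 2) : ℚ_[p]) := by
  obtain ⟨k, rfl⟩ : ∃ n, k = n + 1 := ⟨k - 1, by omega⟩
  rw [add_pow, Finset.sum_range_succ', Finset.sum_range_succ']
  simp
  ring

theorem aux_norm_one {p : ℕ} [Fact p.Prime] {s : ℚ_[p]} (hs : ‖s - 1‖ < 1) : ‖s‖ = 1 := by
  have := Padic.norm_eq_of_norm_sub_lt_right (z1 := s) (z2 := 1) (by simpa using hs)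
  simpa using this

theorem aux_pow_sub_one {p : ℕ} [Fact p.Prime] {s : ℚ_[p]} (hs : ‖s - 1‖ < 1) (n : ℕ) :
    ‖s ^ n - 1‖ ≤ 1 / p := by
  have h1 : ‖s ^ n - 1‖ < 1 := by
    rw [← geom_sum_mul, norm_mul]
    refine lt_of_le_of_lt (mul_le_of_le_one_left (norm_nonneg _) ?_) hs
    apply IsUltrametricDist.norm_sum_le_of_forall_le_of_nonneg zero_le_one
    intro i _
    simp [aux_norm_one hs]
  have := aux_disc (x := s ^ n - 1) (y := (1 : ℚ_[p])) (by simpa using h1)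
  simpa using this

theorem aux_key {p : ℕ} [hpf : Fact p.Prime] (hp : 3 ≤ p) (k : ℕ) (hk : 1 ≤ k) {s v : ℚ_[p]}
    (hs : ‖s - 1‖ < 1) (hv : ‖v - 1‖ < 1) :
    ‖s ^ k - v ^ k - k * (s - v)‖ ≤ ‖(k : ℚ_[p])‖ * ‖s - v‖ / p := by
  have hd : ‖s - v‖ < 1 := by
    have : s - v = (s - 1) + -(v - 1) := by ring
    rw [this]
    refine lt_of_le_of_lt (Padic.nonarchimedean _ _) ?_
    rw [norm_neg]; exact max_lt hs hv
  have e := aux_binom (s - v) v k hk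
  rw [sub_add_cancel] at e
  have e2 : s ^ k - v ^ k - k * (s - v) =
    (∑ j ∈ Finset.range (k - 1), (s - v) ^ (j + 2) * v ^ (k - (j + 2)) *
      (k.choose (j + 2) : ℚ_[p])) + k * (s - v) * (v ^ (k - 1) - 1) := by
    rw [← e]; ring
  have hp0 : 0 < (p : ℝ) := by exact_mod_cast hpf.out.pos
  rw [e2]
  refine (Padic.nonarchimedean _ _).trans (max_le ?_ ?_)
  · apply IsUltrametricDist.norm_sum_le_of_forall_le_of_nonneg (by positivity)
    intro j _
    have := aux_term hp hd k (j + 1) 1 (j + 1) (aux_three j)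
    rw [pow_one] at this
    refine le_trans (le_of_eq ?_) this
    rw [norm_mul, norm_mul, norm_mul, norm_pow v, aux_norm_one hv, one_pow]
    ring
  · rw [norm_mul, norm_mul, div_eq_mul_one_div]
    gcongr
    exact aux_pow_sub_one hv _

theorem aux_pow_norm {p : ℕ} [hpf : Fact p.Prime] (hp : 3 ≤ p) (k : ℕ) (hk : 1 ≤ k) {s v : ℚ_[p]}
    (hs : ‖s - 1‖ < 1) (hv : ‖v - 1‖ < 1) :
    ‖s ^ k - v ^ k‖ = ‖(k : ℚ_[p])‖ * ‖s - v‖ := by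
  rw [← norm_mul]
  by_cases h : s = v
  · simp [h]
  apply Padic.norm_eq_of_norm_sub_lt_right
  refine lt_of_le_of_lt (aux_key hp k hk hs hv) ?_
  rw [norm_mul]
  apply div_lt_self
  · have : (k : ℚ_[p]) ≠ 0 := by exact_mod_cast (by omega : k ≠ 0)
    have := sub_ne_zero.mpr h
    positivity
  · exact_mod_cast hpf.out.one_lt

theorem aux_choose3 {p : ℕ} [Fact p.Prime] (k : ℕ) :
    ((k.choose 3 : ℕ) : ℚ_[p]) = k * (k - 1) * (k - 2) / 6 := by
  induction k with
  | zero => simp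
  | succ n ih =>
    rw [Nat.choose_succ_succ' n 2, Nat.cast_add, ih, Nat.cast_choose_two]
    push_cast
    ring

theorem aux_center {p : ℕ} [hpf : Fact p.Prime] (hp : 3 ≤ p) (k : ℕ) {w : ℚ_[p]}
    (hw : ‖w‖ < 1) :
    ‖(1 + w) ^ k - 1 - k * w - k * (k - 1) / 2 * w ^ 2 - k * (k - 1) * (k - 2) / 6 * w ^ 3‖
      ≤ ‖(k : ℚ_[p])‖ * ‖w‖ ^ 2 / p := by
  have e : (1 + w) ^ k = ∑ j ∈ Finset.range (k + 4), w ^ j * (k.choose j : ℚ_[p]) := by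
    rw [add_comm, add_pow]
    simp only [one_pow, mul_one]
    refine Finset.sum_subset (Finset.range_mono (by omega)) ?_
    intro j _ hj
    rw [Nat.choose_eq_zero_of_lt (by simpa using hj)]; simp
  rw [e, Finset.sum_range_succ', Finset.sum_range_succ', Finset.sum_range_succ',
    Finset.sum_range_succ']
  have hp0 : 0 < (p : ℝ) := by exact_mod_cast hpf.out.pos
  have e2 : ‖∑ j ∈ Finset.range k, w ^ (j + 4) * (k.choose (j + 4) : ℚ_[p])‖ ≤
      ‖(k : ℚ_[p])‖ * ‖w‖ ^ 2 / p := by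
    apply IsUltrametricDist.norm_sum_le_of_forall_le_of_nonneg (by positivity)
    intro j _
    have := aux_term hp hw k (j + 2) 2 (j + 3) (aux_three' j)
    rw [mul_comm]; exact this
  refine le_trans (le_of_eq (congrArg _ ?_)) e2
  simp only [zero_add, Nat.reduceAdd, Nat.choose_one_right, Nat.choose_zero_right, aux_choose3,
    Nat.cast_choose_two]
  have : ∀ j, j + 1 + 1 + 1 + 1 = j + 4 := fun j => rfl
  simp only [this]
  push_cast
  ring

theorem aux_root {p : ℕ} [hpf : Fact p.Prime] (hp : 3 ≤ p) (k : ℕ) (hk : 1 ≤ k)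
    (hgcd : Nat.gcd k (p - 1) = 1) (ξ : ℚ_[p]) (h : ξ ^ k = 1) : ξ = 1 := by
  have hn : ‖ξ‖ = 1 := by
    have : ‖ξ‖ ^ k = 1 := by rw [← norm_pow, h, norm_one]
    exact (pow_eq_one_iff_of_nonneg (norm_nonneg _) (by omega)).mp this
  let z : ℤ_[p] := ⟨ξ, hn.le⟩
  have hz : z ^ k = 1 := by
    apply Subtype.ext
    push_cast
    exact h
  have hz2 : (PadicInt.toZMod z) ^ k = 1 := by rw [← map_pow, hz, map_one]
  have hz0 : PadicInt.toZMod z ≠ 0 := by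
    intro h0; rw [h0, zero_pow (by omega)] at hz2; exact zero_ne_one hz2
  have hz3 := ZMod.pow_card_sub_one_eq_one hz0
  have hz4 : PadicInt.toZMod z = 1 := by
    rw [← orderOf_eq_one_iff]
    have := Nat.dvd_gcd (orderOf_dvd_of_pow_eq_one hz2) (orderOf_dvd_of_pow_eq_one hz3)
    rw [hgcd] at this
    exact Nat.dvd_one.mp this
  have hz5 : z - 1 ∈ RingHom.ker (PadicInt.toZMod : ℤ_[p] →+* ZMod p) := by
    rw [RingHom.mem_ker, map_sub, hz4, map_one, sub_self]
  rw [PadicInt.ker_toZMod, IsLocalRing.mem_maximalIdeal, PadicInt.mem_nonunits] at hz5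
  have hz6 : ‖ξ - 1‖ < 1 := by
    have : ((z - 1 : ℤ_[p]) : ℚ_[p]) = ξ - 1 := by push_cast; rfl
    rw [← this]; exact hz5
  have := aux_pow_norm hp k hk hz6 (v := 1) (by simp)
  rw [h] at this
  simp only [one_pow, sub_self, norm_zero] at this
  have hk0 : (k : ℚ_[p]) ≠ 0 := by exact_mod_cast (by omega : k ≠ 0)
  have := (mul_eq_zero.mp this.symm).resolve_left (norm_ne_zero_iff.mpr hk0)
  exact sub_eq_zero.mp (norm_eq_zero.mp this)

theorem aux_geom_lip {p : ℕ} [hpf : Fact p.Prime] (hp : 3 ≤ p) (k : ℕ) {s v : ℚ_[p]}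
    (hs : ‖s - 1‖ < 1) (hv : ‖v - 1‖ < 1) :
    ‖(∑ i ∈ Finset.range k, s ^ i) - ∑ i ∈ Finset.range k, v ^ i‖ ≤ ‖s - v‖ := by
  rw [← Finset.sum_sub_distrib]
  apply IsUltrametricDist.norm_sum_le_of_forall_le_of_nonneg (norm_nonneg _)
  intro i _
  rcases Nat.eq_zero_or_pos i with rfl | hi
  · simp
  · rw [aux_pow_norm hp i hi hs hv]
    exact mul_le_of_le_one_left (norm_nonneg _) (aux_nat_le _)

theorem aux_fix {p : ℕ} [hpf : Fact p.Prime] (hp : 3 ≤ p) (k : ℕ) (hk : 1 ≤ k) (q t : ℚ_[p])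
    (hqk : ‖q‖ < ‖(k : ℚ_[p])‖) (ht : ‖t‖ < ‖q‖ ^ 2) :
    ∃ s : ℚ_[p], ‖s - 1‖ ≤ ‖q / k‖ ∧ s ^ k = 1 - q + t * ((∑ i ∈ Finset.range k, s ^ i) - 1) := by
  have hk0 : (k : ℚ_[p]) ≠ 0 := by exact_mod_cast (by omega : k ≠ 0)
  have hkn : 0 < ‖(k : ℚ_[p])‖ := norm_pos_iff.mpr hk0
  have hk1 : ‖(k : ℚ_[p])‖ ≤ 1 := aux_nat_le k
  have hp0 : 0 < (p : ℝ) := by exact_mod_cast hpf.out.pos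
  have hp1 : 1 < (p : ℝ) := by exact_mod_cast hpf.out.one_lt
  have hq0 := norm_nonneg q
  have htq : ‖t‖ < ‖q‖ := by nlinarith
  have htk : ‖t‖ / ‖(k : ℚ_[p])‖ ≤ 1 / p := by
    have := aux_disc (htq.trans hqk)
    rw [div_le_iff₀ hkn]
    calc _ ≤ _ := this
      _ = _ := by ring
  have hρ : ‖q / k‖ < 1 := by rw [norm_div, div_lt_one hkn]; exact hqk
  let T : ℚ_[p] → ℚ_[p] := fun s =>
    s - (s ^ k - 1 + q - t * ((∑ i ∈ Finset.range k, s ^ i) - 1)) / k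
  have hlip : ∀ s v : ℚ_[p], ‖s - 1‖ < 1 → ‖v - 1‖ < 1 → ‖T s - T v‖ ≤ 1 / p * ‖s - v‖ := by
    intro s v hs hv
    have e : T s - T v = -((s ^ k - v ^ k - k * (s - v)) / k) +
        t * ((∑ i ∈ Finset.range k, s ^ i) - ∑ i ∈ Finset.range k, v ^ i) / k := by
      simp only [T]; field_simp; ring
    rw [e]
    refine (Padic.nonarchimedean _ _).trans (max_le ?_ ?_)
    · rw [norm_neg, norm_div, div_le_iff₀ hkn]
      calc _ ≤ _ := aux_key hp k hk hs hv
        _ = _ := by ring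
    · rw [norm_div, norm_mul, mul_div_right_comm]
      gcongr
      exact aux_geom_lip hp k hs hv
  have hT1 : ‖T 1 - 1‖ ≤ ‖q / k‖ := by
    have e : T 1 - 1 = -(q / k) + (t / k) * ((k - 1 : ℕ) : ℚ_[p]) := by
      rw [Nat.cast_sub hk]
      simp only [T]; simp; field_simp; ring
    rw [e]
    refine (Padic.nonarchimedean _ _).trans (max_le ?_ ?_)
    · rw [norm_neg]
    · rw [norm_mul]
      refine (mul_le_of_le_one_right (norm_nonneg _) (aux_nat_le _)).trans ?_
      rw [norm_div, norm_div]; gcongr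
  have hmaps : Set.MapsTo T (Metric.closedBall 1 ‖q / k‖) (Metric.closedBall 1 ‖q / k‖) := by
    intro s hs
    rw [mem_closedBall_iff_norm] at hs ⊢
    have e : T s - 1 = (T s - T 1) + (T 1 - 1) := by ring
    rw [e]
    refine (Padic.nonarchimedean _ _).trans (max_le ?_ hT1)
    refine (hlip s 1 (hs.trans_lt hρ) (by simp)).trans ?_
    refine (mul_le_of_le_one_left (norm_nonneg _) ?_).trans hs
    rw [div_le_one hp0]; exact hp1.le
  have hc : ContractingWith (1 / (p : NNReal)) (hmaps.restrict T _ _) := by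
    constructor
    · rw [one_div]
      apply inv_lt_one_of_one_lt₀
      exact_mod_cast hpf.out.one_lt
    · apply LipschitzWith.of_dist_le_mul
      intro x y
      have hx := x.2
      have hy := y.2
      rw [mem_closedBall_iff_norm] at hx hy
      have := hlip x y (hx.trans_lt hρ) (hy.trans_lt hρ)
      rw [Subtype.dist_eq, Subtype.dist_eq, dist_eq_norm, dist_eq_norm]
      simpa using this
  obtain ⟨s, hs, hfix, -⟩ := hc.exists_fixedPoint' (Metric.isClosed_closedBall.isComplete) hmaps
    (x := 1) (Metric.mem_closedBall_self (norm_nonneg _)) (edist_ne_top _ _)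
  rw [mem_closedBall_iff_norm] at hs
  refine ⟨s, hs, ?_⟩
  have h1 : T s = s := hfix
  simp only [T] at h1
  rw [sub_eq_self, div_eq_zero_iff] at h1
  have := h1.resolve_right hk0
  linear_combination this

/-- Facts about the multiplier `s` of the fixed point. -/
theorem aux_facts {p : ℕ} [hpf : Fact p.Prime] (hp : 3 ≤ p) (k : ℕ) (hk : 1 ≤ k) (q t s : ℚ_[p])
    (hqk : ‖q‖ < ‖(k : ℚ_[p])‖) (ht : ‖t‖ < ‖q‖ ^ 2) (hs : ‖s - 1‖ ≤ ‖q / k‖)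
    (hE : s ^ k = 1 - q + t * ((∑ i ∈ Finset.range k, s ^ i) - 1)) :
    ‖∑ i ∈ Finset.range k, s ^ i‖ = ‖(k : ℚ_[p])‖ ∧
    ‖(∑ i ∈ Finset.range k, s ^ i) - 1‖ ≤ 1 ∧
    ‖(∑ i ∈ Finset.range k, s ^ i) - 1 -
      ((k : ℚ_[p]) - 1) * (1 - q / 2 + ((k : ℚ_[p]) - 2) * q ^ 2 / (6 * k))‖ < ‖q‖ := by
  have hk0 : (k : ℚ_[p]) ≠ 0 := by exact_mod_cast (by omega : k ≠ 0)
  have hkn : 0 < ‖(k : ℚ_[p])‖ := norm_pos_iff.mpr hk0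
  have hk1 : ‖(k : ℚ_[p])‖ ≤ 1 := aux_nat_le k
  have hp0 : 0 < (p : ℝ) := by exact_mod_cast hpf.out.pos
  have hp1 : 1 < (p : ℝ) := by exact_mod_cast hpf.out.one_lt
  have hq0 := norm_nonneg q
  have hqpos : 0 < ‖q‖ := by
    have := norm_nonneg t
    by_contra h
    have : ‖q‖ = 0 := le_antisymm (not_lt.mp h) hq0
    rw [this] at ht; norm_num at ht; linarith
  have htq : ‖t‖ < ‖q‖ := by nlinarith
  have hρ : ‖q / k‖ < 1 := by rw [norm_div, div_lt_one hkn]; exact hqk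
  have hs1 := hs.trans_lt hρ
  set Φ := ∑ i ∈ Finset.range k, s ^ i with hΦ
  obtain ⟨w, rfl⟩ : ∃ w, s = 1 + w := ⟨s - 1, by ring⟩
  have hΦw : Φ * w = (1 + w) ^ k - 1 := by
    rw [hΦ, ← geom_sum_mul, add_sub_cancel_left]
  rw [add_sub_cancel_left] at hs hs1
  have hΦ1 : ‖Φ - 1‖ ≤ 1 := by
    have h1 : ‖Φ‖ ≤ 1 := by
      apply IsUltrametricDist.norm_sum_le_of_forall_le_of_nonneg zero_le_one
      intro i _
      rw [norm_pow, aux_norm_one (by simpa using hs1), one_pow]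
    rw [sub_eq_add_neg]
    refine (Padic.nonarchimedean _ _).trans (max_le h1 (by simp))
  have hkw : ‖(k : ℚ_[p]) * w‖ ≤ ‖q‖ := by
    rw [norm_mul]
    calc _ ≤ ‖(k : ℚ_[p])‖ * ‖q / k‖ := by gcongr
      _ = ‖q‖ := by rw [norm_div]; field_simp
  have hkq : ‖(k : ℚ_[p]) * w + q‖ < ‖q‖ := by
    have e : (k : ℚ_[p]) * w + q = t * (Φ - 1) + -((1 + w) ^ k - 1 ^ k - k * (1 + w - 1)) := by
      rw [hE]; ring
    rw [e]
    refine (Padic.nonarchimedean _ _).trans_lt (max_lt ?_ ?_)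
    · rw [norm_mul]
      exact (mul_le_of_le_one_right (norm_nonneg _) hΦ1).trans_lt htq
    · rw [norm_neg]
      refine (aux_key hp k hk (by simpa using hs1) (by simp)).trans_lt ?_
      rw [add_sub_cancel_left, ← norm_mul]
      exact lt_of_le_of_lt (div_le_div_of_nonneg_right hkw hp0.le) (div_lt_self hqpos hp1)
  have hkwq : ‖(k : ℚ_[p]) * w‖ = ‖q‖ := by
    have := Padic.norm_eq_of_norm_sub_lt_right (z1 := (k : ℚ_[p]) * w) (z2 := -q) (by simpa using hkq)
    simpa using this
  have hw0 : w ≠ 0 := by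
    rintro rfl
    simp at hkwq
    exact hqpos.ne hkwq
  have hwn : 0 < ‖w‖ := norm_pos_iff.mpr hw0
  have h2 : ‖(2 : ℚ_[p])‖ = 1 := by
    have := Padic.norm_natCast_eq_one_iff (p := p) (n := 2)
    rw [Nat.cast_ofNat] at this
    rw [this]
    exact (Nat.coprime_primes hpf.out Nat.prime_two).mpr (by omega)
  have h3 : 1 / (p : ℝ) ≤ ‖(3 : ℚ_[p])‖ := by
    rcases Nat.lt_or_ge 3 p with h | h
    · have := Padic.norm_natCast_eq_one_iff (p := p) (n := 3)
      rw [Nat.cast_ofNat] at this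
      rw [this.mpr ((Nat.coprime_primes hpf.out Nat.prime_three).mpr (by omega)), div_le_one hp0]
      exact hp1.le
    · have h : p = 3 := by omega
      subst h
      have := Padic.norm_p (p := 3)
      simpa using this.ge
  refine ⟨?_, hΦ1, ?_⟩
  · have := aux_pow_norm hp k hk (s := 1 + w) (v := 1) (by simpa using hs1) (by simp)
    rw [one_pow, ← hΦw, add_sub_cancel_left, norm_mul] at this
    exact mul_right_cancel₀ hwn.ne' this
  · have hR := aux_center hp k hs1
    have e0 : (1 + w) ^ k - 1 - k * w - k * (k - 1) / 2 * w ^ 2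
        - k * (k - 1) * (k - 2) / 6 * w ^ 3
        = w * (Φ - k - k * (k - 1) / 2 * w - k * (k - 1) * (k - 2) / 6 * w ^ 2) := by
      linear_combination -hΦw
    rw [e0, norm_mul] at hR
    have hR2 : ‖Φ - k - k * (k - 1) / 2 * w - k * (k - 1) * (k - 2) / 6 * w ^ 2‖ < ‖q‖ := by
      have : ‖w‖ * ‖Φ - k - k * (k - 1) / 2 * w - k * (k - 1) * (k - 2) / 6 * w ^ 2‖
          ≤ ‖w‖ * (‖q‖ / p) := by
        refine hR.trans (le_of_eq ?_)
        rw [← hkwq, norm_mul]; ring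
      exact (le_of_mul_le_mul_left this hwn).trans_lt (div_lt_self hqpos hp1)
    have hkm1 : ‖(k : ℚ_[p]) - 1‖ ≤ 1 := by
      simpa using Padic.norm_int_le_one (p := p) ((k : ℤ) - 1)
    have hkm2 : ‖(k : ℚ_[p]) - 2‖ ≤ 1 := by
      simpa using Padic.norm_int_le_one (p := p) ((k : ℤ) - 2)
    have e : Φ - 1 - ((k : ℚ_[p]) - 1) * (1 - q / 2 + ((k : ℚ_[p]) - 2) * q ^ 2 / (6 * k)) =
        (Φ - k - k * (k - 1) / 2 * w - k * (k - 1) * (k - 2) / 6 * w ^ 2) +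
        (((k : ℚ_[p]) - 1) * (k * w + q) / 2 +
          (k - 1) * (k - 2) * ((k * w - q) / k / 3 * (k * w + q)) / 2) := by
      field_simp
      ring
    rw [e]
    refine (Padic.nonarchimedean _ _).trans_lt (max_lt hR2 ?_)
    refine (Padic.nonarchimedean _ _).trans_lt (max_lt ?_ ?_)
    · rw [norm_div, h2, div_one, norm_mul]
      exact (mul_le_of_le_one_left (norm_nonneg _) hkm1).trans_lt hkq
    · rw [norm_div, h2, div_one, norm_mul, norm_mul]
      refine (mul_le_of_le_one_left (norm_nonneg _)
        (mul_le_one₀ hkm1 (norm_nonneg _) hkm2)).trans_lt ?_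
      rw [norm_mul]
      refine (mul_le_of_le_one_left (norm_nonneg _) ?_).trans_lt hkq
      have h3n : 0 < ‖(3 : ℚ_[p])‖ := lt_of_lt_of_le (by positivity) h3
      rw [norm_div, norm_div, div_le_one h3n]
      refine le_trans ?_ h3
      have a1 : ‖(k : ℚ_[p]) * w - q‖ ≤ ‖q‖ := by
        rw [sub_eq_add_neg]
        exact (Padic.nonarchimedean _ _).trans (max_le hkw (by simp))
      have a2 := aux_disc hqk
      rw [div_le_iff₀ hkn]
      calc _ ≤ _ := a1
        _ ≤ _ := a2
        _ = _ := by ring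

theorem aux_main {p : ℕ} [hpf : Fact p.Prime] (hp : 3 ≤ p) (q k : ℕ) (hk : 1 ≤ k)
    (θ : ℚ_[p]) (hθ1 : θ ≠ 1) (hqk : ‖(q : ℚ_[p])‖ < ‖(k : ℚ_[p])‖)
    (hθq : ‖θ - 1‖ < ‖(q : ℚ_[p])‖ ^ 2) (hgcd : Nat.gcd k (p - 1) = 1) :
    ∃ x : ℚ_[p], x ≠ 1 ∧ x ≠ 0 ∧ pottsBethe p q k θ x = x ∧ x ∈ XSet p q k θ ∧
      (∀ z ∈ XSet p q k θ, ‖pottsBethe p q k θ z - x‖ =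
        ‖(q : ℚ_[p])‖ / (‖(k : ℚ_[p])‖ * ‖θ - 1‖) * ‖z - x‖) ∧
      (∀ z, pottsBethe p q k θ z = x → z = x) := by
  obtain ⟨t, rfl⟩ : ∃ t, θ = 1 + t := ⟨θ - 1, by ring⟩
  rw [add_sub_cancel_left] at hθq
  have ht0 : t ≠ 0 := by rintro rfl; simp at hθ1
  have htn : 0 < ‖t‖ := norm_pos_iff.mpr ht0
  obtain ⟨s, hs, hE⟩ := aux_fix hp k hk q t hqk hθq
  obtain ⟨h1, h2, h3⟩ := aux_facts hp k hk q t s hqk hθq hs hE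
  have hk0 : (k : ℚ_[p]) ≠ 0 := by exact_mod_cast (by omega : k ≠ 0)
  have hkn : 0 < ‖(k : ℚ_[p])‖ := norm_pos_iff.mpr hk0
  have hk1 : ‖(k : ℚ_[p])‖ ≤ 1 := aux_nat_le k
  have hq0 := norm_nonneg (q : ℚ_[p])
  have htq : ‖t‖ < ‖(q : ℚ_[p])‖ := by nlinarith
  have hqpos : 0 < ‖(q : ℚ_[p])‖ := htn.trans htq
  have hs1 : ‖s - 1‖ < 1 := by
    refine hs.trans_lt ?_
    rw [norm_div, div_lt_one hkn]; exact hqk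
  have hgeo : (∑ i ∈ Finset.range k, s ^ i) * (s - 1) = s ^ k - 1 := geom_sum_mul s k
  set Φ := ∑ i ∈ Finset.range k, s ^ i with hΦ
  have hΦ0 : Φ ≠ 0 := by rw [← norm_ne_zero_iff, h1]; exact hkn.ne'
  have hroot : ∀ ξ : ℚ_[p], ξ ^ k = 1 → ξ = 1 := aux_root hp k hk hgcd
  have hs0 : s ≠ 0 := by
    rintro rfl
    simp at hs1
  have hx0 : s ^ k ≠ 0 := pow_ne_zero _ hs0
  -- formula for the Möbius map
  have hg : ∀ y : ℚ_[p], y + 1 ≠ 0 → ((1 + t) * (1 - q + t * y) + (q : ℚ_[p]) - 1) /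
      ((1 - q + t * y) + (1 + t) + q - 2) = 1 + t - (q + t) / (y + 1) := by
    intro y hy
    have e : (1 - q + t * y) + (1 + t) + (q : ℚ_[p]) - 2 = t * (y + 1) := by ring
    rw [e]
    field_simp
    ring
  have hgs : 1 + t - (q + t) / Φ = s := by
    field_simp
    linear_combination -hE - hgeo
  have hqt : ‖(q : ℚ_[p]) + t‖ = ‖(q : ℚ_[p])‖ := by
    apply Padic.norm_eq_of_norm_sub_lt_right
    simpa using htq
  have hqt0 : (q : ℚ_[p]) + t ≠ 0 := by rw [← norm_ne_zero_iff, hqt]; exact hqpos.ne'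
  refine ⟨s ^ k, ?_, hx0, ?_, ?_, ?_, ?_⟩
  · intro h
    rw [h] at hE
    have : (q : ℚ_[p]) = t * (Φ - 1) := by linear_combination hE
    have h4 : ‖(q : ℚ_[p])‖ ≤ ‖t‖ := by
      rw [this, norm_mul]; exact mul_le_of_le_one_right (norm_nonneg _) h2
    linarith
  · have := hg (Φ - 1) (by simpa using hΦ0)
    rw [sub_add_cancel, hgs, ← hE] at this
    show (_ / _) ^ k = _
    rw [this]
  · refine ⟨1, one_pow k, ?_⟩
    rw [xiCenter, if_pos rfl, add_sub_cancel_left, norm_mul, hE]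
    have e : 1 - (q : ℚ_[p]) + t * (Φ - 1) - (1 - (q : ℚ_[p]) + ((k : ℚ_[p]) - 1) *
      (1 - (q : ℚ_[p]) / 2 + ((k : ℚ_[p]) - 2) * (q : ℚ_[p]) ^ 2 / (6 * (k : ℚ_[p]))) * t) =
      (Φ - 1 - ((k : ℚ_[p]) - 1) *
        (1 - (q : ℚ_[p]) / 2 + ((k : ℚ_[p]) - 2) * (q : ℚ_[p]) ^ 2 / (6 * k))) * t := by ring
    rw [e, norm_mul]
    gcongr
  · rintro z ⟨ξ, hξ, hz⟩
    obtain rfl := hroot ξ hξ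
    rw [xiCenter, if_pos rfl, add_sub_cancel_left, norm_mul] at hz
    obtain ⟨y, rfl⟩ : ∃ y, z = 1 - q + t * y := ⟨(z - 1 + q) / t, by field_simp; ring⟩
    have e : 1 - (q : ℚ_[p]) + t * y - (1 - (q : ℚ_[p]) + ((k : ℚ_[p]) - 1) *
      (1 - (q : ℚ_[p]) / 2 + ((k : ℚ_[p]) - 2) * (q : ℚ_[p]) ^ 2 / (6 * (k : ℚ_[p]))) * t) =
      (y - ((k : ℚ_[p]) - 1) *
        (1 - (q : ℚ_[p]) / 2 + ((k : ℚ_[p]) - 2) * (q : ℚ_[p]) ^ 2 / (6 * k))) * t := by ring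
    rw [e, norm_mul] at hz
    have hz2 := lt_of_mul_lt_mul_right hz (norm_nonneg _)
    have hy : ‖y + 1 - Φ‖ < ‖(q : ℚ_[p])‖ := by
      have e2 : y + 1 - Φ = (y - ((k : ℚ_[p]) - 1) *
        (1 - (q : ℚ_[p]) / 2 + ((k : ℚ_[p]) - 2) * (q : ℚ_[p]) ^ 2 / (6 * k))) +
        -(Φ - 1 - ((k : ℚ_[p]) - 1) *
        (1 - (q : ℚ_[p]) / 2 + ((k : ℚ_[p]) - 2) * (q : ℚ_[p]) ^ 2 / (6 * k))) := by ring
      rw [e2]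
      refine (Padic.nonarchimedean _ _).trans_lt (max_lt hz2 ?_)
      rw [norm_neg]; exact h3
    have hyk : ‖y + 1‖ = ‖(k : ℚ_[p])‖ := by
      rw [← h1]
      apply Padic.norm_eq_of_norm_sub_lt_right
      rw [h1]; exact hy.trans hqk
    have hy0 : y + 1 ≠ 0 := by rw [← norm_ne_zero_iff, hyk]; exact hkn.ne'
    have hf : pottsBethe p q k (1 + t) (1 - q + t * y) = (1 + t - (q + t) / (y + 1)) ^ k := by
      rw [← hg y hy0]; rfl
    rw [hf]
    set g := 1 + t - (q + t) / (y + 1) with hgdef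
    have hgsub : g - s = (q + t) * (y + 1 - Φ) / ((y + 1) * Φ) := by
      rw [← hgs, hgdef]; field_simp; ring
    have hgn : ‖g - s‖ =
        ‖(q : ℚ_[p])‖ * ‖y + 1 - Φ‖ / (‖(k : ℚ_[p])‖ * ‖(k : ℚ_[p])‖) := by
      rw [hgsub, norm_div, norm_mul, norm_mul, hqt, hyk, h1]
    have hg1 : ‖g - 1‖ < 1 := by
      have e3 : g - 1 = (g - s) + (s - 1) := by ring
      rw [e3]
      refine (Padic.nonarchimedean _ _).trans_lt (max_lt ?_ hs1)
      rw [hgn, div_lt_one (by positivity)]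
      exact mul_lt_mul'' hqk (hy.trans hqk) hq0 (norm_nonneg _)
    rw [aux_pow_norm hp k hk hg1 hs1, hgn, hE]
    have e4 : 1 - (q : ℚ_[p]) + t * y - (1 - (q : ℚ_[p]) + t * (Φ - 1)) = t * (y + 1 - Φ) := by
      ring
    rw [e4, norm_mul, add_sub_cancel_left]
    field_simp
  · intro z hz
    obtain ⟨y, rfl⟩ : ∃ y, z = 1 - q + t * y := ⟨(z - 1 + q) / t, by field_simp; ring⟩
    have hy0 : y + 1 ≠ 0 := by
      intro h
      apply hx0
      rw [← hz]
      have e : (1 - q + t * y) + (1 + t) + (q : ℚ_[p]) - 2 = 0 := by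
        linear_combination t * h
      show (_ / _) ^ k = _
      rw [e, div_zero, zero_pow (by omega)]
    have hf : pottsBethe p q k (1 + t) (1 - q + t * y) = (1 + t - (q + t) / (y + 1)) ^ k := by
      rw [← hg y hy0]; rfl
    rw [hf] at hz
    have h5 : (1 + t - (q + t) / (y + 1)) / s = 1 := by
      apply hroot
      rw [div_pow, hz, div_self hx0]
    rw [div_eq_one_iff_eq hs0] at h5
    have h6 : y + 1 = Φ := by
      have h7 : (q + t) / (y + 1) = (q + t) / Φ := by linear_combination hgs - h5
      rw [div_eq_div_iff hy0 hΦ0] at h7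
      exact (mul_left_cancel₀ hqt0 h7).symm
    rw [hE, ← h6]; ring

theorem stmt10 (p : ℕ) [Fact p.Prime] (hp : 3 ≤ p) (q k : ℕ) (hq : 1 ≤ q) (hk : 1 ≤ k)
    (θ : ℚ_[p]) (hθ1 : θ ≠ 1) (hqk : ‖(q : ℚ_[p])‖ < ‖(k : ℚ_[p])‖)
    (hθq : ‖θ - 1‖ < ‖(q : ℚ_[p])‖ ^ 2) (hgcd : Nat.gcd k (p - 1) = 1) :
    ∃ x : ℚ_[p], x ≠ 1 ∧ pottsBethe p q k θ x = x ∧ JSet p q k θ = {x} := by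
  obtain ⟨x, hx1, -, hfx, hxX, hexp, hinj⟩ := aux_main hp q k hk θ hθ1 hqk hθq hgcd
  refine ⟨x, hx1, hfx, ?_⟩
  set f := pottsBethe p q k θ with hf
  have hk1 : ‖(k : ℚ_[p])‖ ≤ 1 := aux_nat_le k
  have hq0 := norm_nonneg (q : ℚ_[p])
  have htn : 0 < ‖θ - 1‖ := norm_pos_iff.mpr (sub_ne_zero.mpr hθ1)
  have hkn : 0 < ‖(k : ℚ_[p])‖ := hq0.trans_lt hqk
  have hlam : 1 < ‖(q : ℚ_[p])‖ / (‖(k : ℚ_[p])‖ * ‖θ - 1‖) := by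
    rw [one_lt_div (by positivity)]
    nlinarith
  set lam := ‖(q : ℚ_[p])‖ / (‖(k : ℚ_[p])‖ * ‖θ - 1‖) with hlamdef
  ext z
  simp only [JSet, Set.mem_iInter, Set.mem_Ici, Set.mem_preimage, Set.mem_singleton_iff]
  constructor
  · intro h
    apply hinj
    by_contra hne
    have hpos : 0 < ‖f z - x‖ := norm_pos_iff.mpr (sub_ne_zero.mpr hne)
    have hit : ∀ n : ℕ, ‖f^[n + 1] z - x‖ = lam ^ n * ‖f z - x‖ := by
      intro n
      induction n with
      | zero => simp
      | succ n ih =>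
        rw [Function.iterate_succ_apply', hexp _ (h (n + 1) (by omega)), ih, pow_succ]
        ring
    -- all elements of `X` lie in one ball
    have hbd : ∀ n : ℕ, ‖f^[n + 1] z - x‖ ≤ ‖(q : ℚ_[p]) * (θ - 1)‖ := by
      intro n
      obtain ⟨ξ, hξ, h1⟩ := h (n + 1) (by omega)
      obtain ⟨η, hη, h2⟩ := hxX
      rw [aux_root hp k hk hgcd ξ hξ] at h1
      rw [aux_root hp k hk hgcd η hη] at h2
      have e : f^[n + 1] z - x = (f^[n + 1] z - xiCenter p q k θ 1) +
        -(x - xiCenter p q k θ 1) := by ring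
      rw [e]
      refine (Padic.nonarchimedean _ _).trans (max_le h1.le ?_)
      rw [norm_neg]; exact h2.le
    obtain ⟨n, hn⟩ := pow_unbounded_of_one_lt (‖(q : ℚ_[p]) * (θ - 1)‖ / ‖f z - x‖) hlam
    rw [div_lt_iff₀ hpos] at hn
    have := hbd n
    rw [hit n] at this
    linarith
  · rintro rfl n _
    rw [Function.iterate_fixed hfx]
    exact hxX
end

section
/- Let p ≥ 3 be a prime, let q, k ≥ 1 be natural numbers and θ ∈ ℚ_p with θ ≠ 1, |q|_p < |k|_p, |θ − 1|_p < |q|_p², and suppose κ := gcd(k, p − 1) ≥ 2. Let J := ⋂_{n≥1} f^{−n}(X), equipped with the subspace topology from ℚ_p. Then f maps J into J, and (J, f) is topologically conjugate to the full one-sided shift on κ symbols: there is a homeomorphism h from J onto the product space (ℕ → Fin κ) such that h(f(x)) = σ(h(x)) for all x ∈ J, where σ is the shift map σ(a)(n) = a(n+1). -/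
open scoped Classical

theorem abstract_coding {E : Type*} [MetricSpace E] {m : ℕ} (X : Set E)
    (hXc : IsComplete X) (hXb : Bornology.IsBounded X) (hXn : X.Nonempty)
    (f : E → E) (V : Fin m → Set E) (hV : ∀ i j x, x ∈ V i → x ∈ V j → i = j)
    (φ : Fin m → E → E) (hφX : ∀ i, ∀ y ∈ X, φ i y ∈ X) (hφV : ∀ i, ∀ y ∈ X, φ i y ∈ V i)
    (hfφ : ∀ i, ∀ y ∈ X, f (φ i y) = y)
    (hcov : ∀ x, f x ∈ X → ∃ i, x = φ i (f x))
    (c : NNReal) (hc : c < 1)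
    (hcon : ∀ i, ∀ y ∈ X, ∀ y' ∈ X, dist (φ i y) (φ i y') ≤ c * dist y y')
    (J : Set E) (hJ : J = ⋂ n ∈ Set.Ici 1, f^[n] ⁻¹' X) :
    Set.MapsTo f J J ∧ ∃ e : J ≃ₜ (ℕ → Fin m),
      ∀ (x : E) (hx : x ∈ J) (hfx : f x ∈ J), e ⟨f x, hfx⟩ = fun n => e ⟨x, hx⟩ (n + 1) := by
  have memJ : ∀ x, x ∈ J ↔ ∀ n, f^[n+1] x ∈ X := by
    intro x
    rw [hJ]
    simp only [Set.mem_iInter, Set.mem_Ici, Set.mem_preimage]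
    constructor
    · intro h n; exact h _ (by omega)
    · intro h n hn
      obtain ⟨n, rfl⟩ := Nat.exists_eq_add_of_le' hn
      exact h n
  have hmaps : Set.MapsTo f J J := by
    intro x hx
    rw [memJ] at hx ⊢
    intro n
    have := hx (n+1)
    rwa [Function.iterate_succ_apply] at this
  refine ⟨hmaps, ?_⟩
  have hJX : J ⊆ X := by
    intro x hx
    rw [memJ] at hx
    have h0 : f x ∈ X := hx 0
    obtain ⟨i, hi⟩ := hcov x h0
    rw [hi]; exact hφX i _ h0
  have : CompleteSpace X := hXc.completeSpace_coe
  have : Nonempty X := hXn.to_subtype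
  let S : (ℕ → Fin m) → (ℕ → Fin m) := fun a n => a (n+1)
  have hS : Continuous S := by
    apply continuous_pi; intro n; exact continuous_apply (n+1)
  let ψ : Fin m → X → X := fun i y => ⟨φ i y, hφX i y y.2⟩
  have hψ : ∀ i, LipschitzWith c (ψ i) := fun i =>
    LipschitzWith.of_dist_le_mul fun y y' => hcon i y y.2 y' y'.2
  have hψc : Continuous (fun z : Fin m × X => ψ z.1 z.2) :=
    continuous_prod_of_discrete_left.mpr fun i => (hψ i).continuous
  let T : C(ℕ → Fin m, X) → C(ℕ → Fin m, X) := fun G =>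
    ⟨fun a => ψ (a 0) (G (S a)), hψc.comp ((continuous_apply 0).prodMk (G.continuous.comp hS))⟩
  have hT : ContractingWith c T := by
    refine ⟨hc, LipschitzWith.of_dist_le_mul fun G H => ?_⟩
    rw [ContinuousMap.dist_le (by positivity)]
    intro a
    refine ((hψ (a 0)).dist_le_mul _ _).trans ?_
    gcongr
    exact ContinuousMap.dist_apply_le_dist _
  have : Nonempty C(ℕ → Fin m, X) := ⟨ContinuousMap.const _ (Classical.arbitrary X)⟩
  obtain ⟨G, hG⟩ : ∃ G, T G = G := ⟨_, hT.fixedPoint_isFixedPt⟩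
  have hGe : ∀ a, (G a : E) = φ (a 0) (G (S a)) := by
    intro a
    conv_lhs => rw [← hG]
    rfl
  have hfG : ∀ a, f (G a) = G (S a) := by
    intro a
    rw [hGe a, hfφ _ _ (G (S a)).2]
  have hGV : ∀ a, (G a : E) ∈ V (a 0) := by
    intro a
    rw [hGe a]; exact hφV _ _ (G (S a)).2
  have hSn : ∀ n (a : ℕ → Fin m), (S^[n] a) = fun i => a (i + n) := by
    intro n
    induction n with
    | zero => intro a; rfl
    | succ n ih => intro a; rw [Function.iterate_succ_apply, ih]; funext i; rfl
  have hfGn : ∀ n a, f^[n] (G a) = G (S^[n] a) := by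
    intro n
    induction n with
    | zero => intro a; rfl
    | succ n ih => intro a; rw [Function.iterate_succ_apply, Function.iterate_succ_apply, hfG, ih]
  have hGJ : ∀ a, (G a : E) ∈ J := by
    intro a
    rw [memJ]; intro n; rw [hfGn]; exact (G _).2
  let F : (ℕ → Fin m) → J := fun a => ⟨G a, hGJ a⟩
  have hFc : Continuous F := by
    apply Continuous.subtype_mk
    exact continuous_subtype_val.comp G.continuous
  have hFi : Function.Injective F := by
    intro a b hab
    have hab' : (G a : E) = G b := congrArg (fun z : J => (z : E)) hab
    funext n
    have h1 : (G (S^[n] a) : E) = G (S^[n] b) := by rw [← hfGn, ← hfGn, hab']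
    have h2 := hGV (S^[n] a)
    have h3 := hGV (S^[n] b)
    rw [← h1] at h3
    have := hV _ _ _ h2 h3
    simpa [hSn] using this
  have hFs : Function.Surjective F := by
    rintro ⟨x, hx⟩
    have hy : ∀ n, f^[n] x ∈ J := fun n => hmaps.iterate n hx
    have : ∀ n, ∃ i, f^[n] x = φ i (f^[n+1] x) := by
      intro n
      have := hcov (f^[n] x) (hJX (hmaps (hy n)))
      rwa [← Function.iterate_succ_apply' f n x] at this
    choose a ha using this
    refine ⟨a, Subtype.ext ?_⟩
    change (G a : E) = x
    obtain ⟨D, hD⟩ := Metric.isBounded_iff.mp hXb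
    have key : ∀ l n, dist (f^[n] x) (G (S^[n] a)) ≤ c^l * D := by
      intro l
      induction l with
      | zero => intro n; simpa using hD (hJX (hy n)) (G _).2
      | succ l ih =>
        intro n
        rw [hGe, ha n]
        have e1 : (S^[n] a) 0 = a n := by simp [hSn]
        have e2 : S (S^[n] a) = S^[n+1] a := by rw [Function.iterate_succ_apply']
        rw [e1, e2]
        calc _ ≤ c * dist (f^[n+1] x) (G (S^[n+1] a)) := hcon _ _ (hJX (hy _)) _ (G _).2
          _ ≤ c * (c^l * D) := by gcongr; exact ih _
          _ = _ := by ring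
    have hlim : Filter.Tendsto (fun l : ℕ => (c:ℝ)^l * D) Filter.atTop (nhds 0) := by
      simpa using (tendsto_pow_atTop_nhds_zero_of_lt_one c.2 (by exact_mod_cast hc)).mul_const D
    have : dist x (G a) ≤ 0 := ge_of_tendsto' hlim fun l => key l 0
    exact (dist_le_zero.mp this).symm
  let e0 : (ℕ → Fin m) ≃ J := Equiv.ofBijective F ⟨hFi, hFs⟩
  let e1 : (ℕ → Fin m) ≃ₜ J := Continuous.homeoOfEquivCompactToT2 (f := e0) hFc
  refine ⟨e1.symm, ?_⟩
  intro x hx hfx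
  rw [Homeomorph.symm_apply_eq]
  apply Subtype.ext
  have h1 : e1 (e1.symm ⟨x, hx⟩) = ⟨x, hx⟩ := e1.apply_symm_apply _
  have h2 : (G (e1.symm ⟨x, hx⟩) : E) = x := congrArg Subtype.val h1
  change f x = G (S (e1.symm ⟨x, hx⟩))
  rw [← hfG, h2]

section
variable {p : ℕ} [Fact p.Prime]

theorem ult_add_le {a b : ℚ_[p]} {C : ℝ} (ha : ‖a‖ ≤ C) (hb : ‖b‖ ≤ C) : ‖a + b‖ ≤ C :=
  (Padic.nonarchimedean a b).trans (max_le ha hb)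

theorem ult_sub_le {a b : ℚ_[p]} {C : ℝ} (ha : ‖a‖ ≤ C) (hb : ‖b‖ ≤ C) : ‖a - b‖ ≤ C := by
  rw [sub_eq_add_neg]; exact ult_add_le ha (by rwa [norm_neg])

theorem ult_add_lt {a b : ℚ_[p]} {C : ℝ} (ha : ‖a‖ < C) (hb : ‖b‖ < C) : ‖a + b‖ < C :=
  (Padic.nonarchimedean a b).trans_lt (max_lt ha hb)

theorem ult_sub_lt {a b : ℚ_[p]} {C : ℝ} (ha : ‖a‖ < C) (hb : ‖b‖ < C) : ‖a - b‖ < C := by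
  rw [sub_eq_add_neg]; exact ult_add_lt ha (by rwa [norm_neg])

/-- If `b` is smaller than `a` then `‖a + b‖ = ‖a‖`. -/
theorem ult_add_eq {a b : ℚ_[p]} (h : ‖b‖ < ‖a‖) : ‖a + b‖ = ‖a‖ := by
  rw [Padic.add_eq_max_of_ne h.ne', max_eq_left h.le]

theorem ult_sub_eq {a b : ℚ_[p]} (h : ‖b‖ < ‖a‖) : ‖a - b‖ = ‖a‖ := by
  rw [sub_eq_add_neg]; exact ult_add_eq (by rwa [norm_neg])

theorem nat_le_one (n : ℕ) : ‖(n : ℚ_[p])‖ ≤ 1 := by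
  have := Padic.norm_int_le_one (p := p) (n : ℤ)
  simpa using this

theorem norm_le_inv {x : ℚ_[p]} (h : ‖x‖ < 1) : ‖x‖ ≤ (p : ℝ)⁻¹ := by
  have := (Padic.norm_le_pow_iff_norm_lt_pow_add_one x (-1)).mpr (by simpa using h)
  simpa using this

theorem norm_choose (k n : ℕ) : ‖(k.choose (n+1) : ℚ_[p])‖ * ‖((n+1 : ℕ) : ℚ_[p])‖ ≤ ‖(k : ℚ_[p])‖ := by
  cases k with
  | zero => simp
  | succ k =>
    rw [← norm_mul, ← Nat.cast_mul, ← Nat.add_one_mul_choose_eq, Nat.cast_mul, norm_mul]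
    exact mul_le_of_le_one_right (norm_nonneg _) (nat_le_one _)

theorem inv_le_norm_nat (n : ℕ) (hn : n ≠ 0) : ((n : ℝ))⁻¹ ≤ ‖(n : ℚ_[p])‖ := by
  rw [Padic.norm_eq_zpow_neg_valuation (by exact_mod_cast hn), Padic.valuation_natCast, zpow_neg, zpow_natCast]
  have h1 : p ^ padicValNat p n ≤ n := Nat.le_of_dvd (Nat.pos_of_ne_zero hn) pow_padicValNat_dvd
  have h2 : 0 < p ^ padicValNat p n := pow_pos (Fact.out : p.Prime).pos _
  apply inv_anti₀
  · exact_mod_cast h2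
  · exact_mod_cast h1

theorem norm_two (hp : 3 ≤ p) : ‖(2 : ℚ_[p])‖ = 1 := by
  have : ‖((2:ℕ) : ℚ_[p])‖ = 1 := by
    rw [Padic.norm_natCast_eq_one_iff]
    rw [Nat.coprime_primes Fact.out Nat.prime_two]; omega
  simpa using this

theorem pow_le_norm2 (hp : 3 ≤ p) (n : ℕ) : ((p : ℝ)⁻¹) ^ n ≤ ‖((n+2 : ℕ) : ℚ_[p])‖ := by
  rcases Nat.eq_zero_or_pos n with rfl | hn
  · simp [norm_two hp]
  · refine le_trans ?_ (inv_le_norm_nat (n+2) (by omega))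
    rw [inv_pow]
    apply inv_anti₀ (by positivity)
    have : n + 2 ≤ p ^ n := by
      refine le_trans ?_ (Nat.pow_le_pow_left hp n)
      induction n, hn using Nat.le_induction with
      | base => norm_num
      | succ n hn ih => rw [pow_succ]; omega
    exact_mod_cast this

theorem pow_le_norm4 (hp : 3 ≤ p) (n : ℕ) : ((p : ℝ)⁻¹) ^ (n+1) ≤ ‖((n+4 : ℕ) : ℚ_[p])‖ := by
  rcases Nat.eq_zero_or_pos n with rfl | hn
  · have : ((0 + 4 : ℕ) : ℚ_[p]) = 2 * 2 := by norm_num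
    rw [this, norm_mul, norm_two hp]
    have h3 : (3:ℝ) ≤ p := by exact_mod_cast hp
    simpa using inv_le_one_of_one_le₀ (by linarith : (1:ℝ) ≤ p)
  · refine le_trans ?_ (inv_le_norm_nat (n+4) (by omega))
    rw [inv_pow]
    apply inv_anti₀ (by positivity)
    have : n + 4 ≤ p ^ (n+1) := by
      refine le_trans ?_ (Nat.pow_le_pow_left hp (n+1))
      induction n, hn using Nat.le_induction with
      | base => norm_num
      | succ n hn ih => rw [pow_succ]; omega
    exact_mod_cast this

theorem binom_ext (s : ℚ_[p]) (k m : ℕ) :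
    (1 + s) ^ k = ∑ n ∈ Finset.range (k + 1 + m), (k.choose n : ℚ_[p]) * s ^ n := by
  rw [add_comm 1 s, add_pow, Finset.sum_range_add _ (k+1) m]
  rw [Finset.sum_eq_zero (s := Finset.range m), add_zero]
  · apply Finset.sum_congr rfl; intro n _; simp [mul_comm]
  · intro n _; rw [Nat.choose_eq_zero_of_lt (by omega)]; simp

theorem norm_pow_sub (s t : ℚ_[p]) {ρ : ℝ} (hρ : 0 ≤ ρ) (hs : ‖s‖ ≤ ρ) (ht : ‖t‖ ≤ ρ) (n : ℕ) :
    ‖s ^ (n+1) - t ^ (n+1)‖ ≤ ρ ^ n * ‖s - t‖ := by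
  induction n with
  | zero => simp
  | succ n ih =>
    have : s ^ (n+1+1) - t^(n+1+1) = s * (s^(n+1) - t^(n+1)) + t^(n+1) * (s - t) := by ring
    rw [this]
    apply ult_add_le
    · rw [norm_mul]
      calc _ ≤ ρ * (ρ ^ n * ‖s - t‖) := by gcongr
        _ = _ := by ring
    · rw [norm_mul, norm_pow]; gcongr

theorem key1 (hp : 3 ≤ p) (k : ℕ) (s t : ℚ_[p]) (hs : ‖s‖ ≤ (p : ℝ)⁻¹) (ht : ‖t‖ ≤ (p : ℝ)⁻¹) :
    ‖(1 + s) ^ k - (1 + t) ^ k - k * (s - t)‖ ≤ (p : ℝ)⁻¹ * (‖(k : ℚ_[p])‖ * ‖s - t‖) := by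
  rw [binom_ext s k 1, binom_ext t k 1, ← Finset.sum_sub_distrib, Finset.sum_range_succ',
    Finset.sum_range_succ']
  simp only [zero_add, Nat.choose_one_right, Nat.choose_zero_right, pow_one, pow_zero]
  have : ∀ A : ℚ_[p], A + ((k:ℚ_[p]) * s - k * t) + (((1:ℕ):ℚ_[p]) * 1 - ((1:ℕ):ℚ_[p]) * 1) - k * (s - t) = A := by
    intro A; ring
  rw [this]
  apply IsUltrametricDist.norm_sum_le_of_forall_le_of_nonneg (by positivity)
  intro n _
  rw [← mul_sub, norm_mul]
  have h1 := norm_choose (p := p) k (n+1)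
  have h2 := pow_le_norm2 hp n
  have h3 := norm_pow_sub s t (by positivity) hs ht (n+1)
  calc _ ≤ ‖(k.choose (n+1+1) : ℚ_[p])‖ * (((p:ℝ)⁻¹) ^ (n+1) * ‖s - t‖) := by gcongr
    _ = (p:ℝ)⁻¹ * ((‖(k.choose (n+1+1) : ℚ_[p])‖ * ((p:ℝ)⁻¹)^n) * ‖s - t‖) := by ring
    _ ≤ (p:ℝ)⁻¹ * ((‖(k.choose (n+1+1) : ℚ_[p])‖ * ‖((n+1+1 : ℕ) : ℚ_[p])‖) * ‖s - t‖) := by gcongr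
    _ ≤ _ := by gcongr

theorem cast_choose_three (k : ℕ) : (k.choose 3 : ℚ_[p]) = k * (k - 1) * (k - 2) / 6 := by
  induction k with
  | zero => simp
  | succ k ih => rw [Nat.choose_succ_succ, Nat.cast_add, ih, Nat.cast_choose_two]; push_cast; ring

theorem key2 (hp : 3 ≤ p) (k : ℕ) (s : ℚ_[p]) (hs : ‖s‖ ≤ (p : ℝ)⁻¹) :
    ‖(1 + s) ^ k - (1 + k * s + k * (k - 1) / 2 * s ^ 2 + k * (k - 1) * (k - 2) / 6 * s ^ 3)‖
      ≤ (p : ℝ)⁻¹ * (‖(k : ℚ_[p])‖ * ‖s‖ ^ 2) := by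
  rw [binom_ext s k 3, Finset.sum_range_succ',
    Finset.sum_range_succ', Finset.sum_range_succ', Finset.sum_range_succ']
  simp only [zero_add, Nat.choose_one_right, Nat.choose_zero_right, pow_one, pow_zero,
    Nat.reduceAdd, Nat.cast_choose_two, cast_choose_three]
  rw [show ∀ A : ℚ_[p], A + (k:ℚ_[p]) * (k - 1) * (k - 2) / 6 * s ^ 3 + (k:ℚ_[p]) * (k - 1) / 2 * s ^ 2 + k * s + ((1:ℕ):ℚ_[p]) * 1 -
    (1 + k * s + k * (k - 1) / 2 * s ^ 2 + k * (k - 1) * (k - 2) / 6 * s ^ 3) = A by intro A; push_cast; ring]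
  apply IsUltrametricDist.norm_sum_le_of_forall_le_of_nonneg (by positivity)
  intro n _
  rw [norm_mul, norm_pow]
  have h1 := norm_choose (p := p) k (n+3)
  have h2 := pow_le_norm4 hp n
  calc _ = ‖(k.choose (n+3+1) : ℚ_[p])‖ * (‖s‖^(n+2) * ‖s‖^2) := by ring_nf
    _ ≤ ‖(k.choose (n+3+1) : ℚ_[p])‖ * (((p:ℝ)⁻¹) ^ (n+2) * ‖s‖^2) := by gcongr
    _ = (p:ℝ)⁻¹ * ((‖(k.choose (n+3+1) : ℚ_[p])‖ * ((p:ℝ)⁻¹)^(n+1)) * ‖s‖^2) := by ring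
    _ ≤ (p:ℝ)⁻¹ * ((‖(k.choose (n+3+1) : ℚ_[p])‖ * ‖((n+3+1 : ℕ) : ℚ_[p])‖) * ‖s‖^2) := by gcongr
    _ ≤ _ := by gcongr

theorem inv_p_lt_one (hp : 3 ≤ p) : (p:ℝ)⁻¹ < 1 := by
  have h3 : (3:ℝ) ≤ p := by exact_mod_cast hp
  exact inv_lt_one_of_one_lt₀ (by linarith)

theorem iso1 (hp : 3 ≤ p) (k : ℕ) (s t : ℚ_[p]) (hs : ‖s‖ ≤ (p : ℝ)⁻¹) (ht : ‖t‖ ≤ (p : ℝ)⁻¹) :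
    ‖(1 + s) ^ k - (1 + t) ^ k‖ = ‖(k : ℚ_[p])‖ * ‖s - t‖ := by
  have h := key1 hp k s t hs ht
  rw [← norm_mul] at h ⊢
  by_cases h0 : (k : ℚ_[p]) * (s - t) = 0
  · rw [h0] at h ⊢
    simpa using h
  · have : (1 + s) ^ k - (1 + t) ^ k = k * (s - t) + ((1 + s) ^ k - (1 + t) ^ k - k * (s - t)) := by ring
    rw [this]
    apply ult_add_eq
    refine h.trans_lt ?_
    exact mul_lt_of_lt_one_left (norm_pos_iff.mpr h0) (inv_p_lt_one hp)

theorem exists_root (hp : 3 ≤ p) (k : ℕ) (y : ℚ_[p]) (hy : ‖y - 1‖ < ‖(k : ℚ_[p])‖) :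
    ∃ s : ℚ_[p], ‖s‖ ≤ (p : ℝ)⁻¹ ∧ (1 + s) ^ k = y := by
  have hk : 0 < ‖(k : ℚ_[p])‖ := (norm_nonneg _).trans_lt hy
  have hk0 : (k : ℚ_[p]) ≠ 0 := norm_pos_iff.mp hk
  have hy' : ‖(y - 1) / k‖ ≤ (p:ℝ)⁻¹ := by
    apply norm_le_inv; rw [norm_div, div_lt_one hk]; exact hy
  let T : ℚ_[p] → ℚ_[p] := fun s => s - ((1 + s) ^ k - y) / k
  let B : Set ℚ_[p] := Metric.closedBall 0 (p:ℝ)⁻¹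
  have hTT : ∀ s t : ℚ_[p], ‖s‖ ≤ (p : ℝ)⁻¹ → ‖t‖ ≤ (p : ℝ)⁻¹ → ‖T s - T t‖ ≤ (p:ℝ)⁻¹ * ‖s - t‖ := by
    intro s t hs ht
    have : T s - T t = -(((1 + s) ^ k - (1 + t) ^ k - k * (s - t)) / k) := by
      simp only [T]; field_simp; ring
    rw [this, norm_neg, norm_div, div_le_iff₀ hk]
    refine (key1 hp k s t hs ht).trans (le_of_eq ?_); ring
  have hB : ∀ s, s ∈ B ↔ ‖s‖ ≤ (p:ℝ)⁻¹ := fun s => by simp [B]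
  have hmaps : Set.MapsTo T B B := by
    intro s hs
    rw [hB] at hs ⊢
    have h1 := hTT s 0 hs (by simp)
    have h2 : T 0 = (y - 1) / k := by simp only [T]; field_simp; ring
    have : T s = (T s - T 0) + T 0 := by ring
    rw [this]
    apply ult_add_le _ (by rw [h2]; exact hy')
    refine h1.trans ?_
    rw [sub_zero]
    exact (mul_le_of_le_one_left (norm_nonneg _) (inv_p_lt_one hp).le).trans hs
  let c : NNReal := ⟨(p:ℝ)⁻¹, by positivity⟩
  have hc : ContractingWith c (hmaps.restrict T B B) := by
    refine ⟨by rw [← NNReal.coe_lt_coe]; exact inv_p_lt_one hp, LipschitzWith.of_dist_le_mul fun s t => ?_⟩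
    have := hTT s t ((hB _).mp s.2) ((hB _).mp t.2)
    rw [Subtype.dist_eq, Subtype.dist_eq, dist_eq_norm, dist_eq_norm]
    exact this
  obtain ⟨s, hs, hfix, -⟩ := hc.exists_fixedPoint' (Metric.isClosed_closedBall.isComplete) hmaps
    (x := 0) (by rw [hB]; simp) (edist_ne_top _ _)
  refine ⟨s, (hB s).mp hs, ?_⟩
  have h : s - ((1 + s) ^ k - y) / k = s := hfix
  have h2 : ((1 + s) ^ k - y) / k = 0 := by linear_combination -h
  rcases div_eq_zero_iff.mp h2 with h3 | h3
  · linear_combination h3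
  · exact absurd h3 hk0

theorem root_norm {k : ℕ} (hk : 1 ≤ k) {ξ : ℚ_[p]} (h : ξ ^ k = 1) : ‖ξ‖ = 1 := by
  have : ‖ξ‖ ^ k = 1 := by rw [← norm_pow, h, norm_one]
  exact (pow_eq_one_iff_of_nonneg (norm_nonneg _) (by omega)).mp this

theorem root_sep (hp : 3 ≤ p) {k : ℕ} (hk : 1 ≤ k) {ξ η : ℚ_[p]} (h : ξ ^ k = 1) (h' : η ^ k = 1)
    (hne : ξ ≠ η) : ‖ξ - η‖ = 1 := by
  have n1 := root_norm hk h
  have n2 := root_norm hk h'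
  by_contra hcon
  have hle : ‖ξ - η‖ ≤ 1 := ult_sub_le n1.le n2.le
  have hlt : ‖ξ - η‖ < 1 := lt_of_le_of_ne hle hcon
  have hη : η ≠ 0 := by rintro rfl; simp at n2
  have hs : ‖(ξ - η) / η‖ ≤ (p:ℝ)⁻¹ := by rw [norm_div, n2, div_one]; exact norm_le_inv hlt
  have := iso1 hp k ((ξ - η)/η) 0 hs (by simp)
  have e : 1 + (ξ - η)/η = ξ / η := by field_simp; ring
  rw [e, div_pow, h, h'] at this
  simp only [add_zero, one_pow, div_one, sub_self, norm_zero, sub_zero] at this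
  rw [norm_div, n2, div_one] at this
  have hk0 : (k : ℚ_[p]) ≠ 0 := by exact_mod_cast (by omega : k ≠ 0)
  rcases mul_eq_zero.mp this.symm with h3 | h3
  · exact hk0 (norm_eq_zero.mp h3)
  · exact hne (sub_eq_zero.mp (norm_eq_zero.mp h3))

theorem card_roots (hp : 3 ≤ p) {k : ℕ} (hk : 1 ≤ k) :
    ∃ r : Fin (Nat.gcd k (p-1)) → ℚ_[p], Function.Injective r ∧ (∀ i, r i ^ k = 1) ∧
      ∀ ξ : ℚ_[p], ξ ^ k = 1 → ∃ i, r i = ξ := by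
  have hpp : p.Prime := Fact.out
  let R := {ξ : ℚ_[p] // ξ ^ k = 1}
  let K := (powMonoidHom k : (ZMod p)ˣ →* (ZMod p)ˣ).ker
  have hK : Nat.card K = Nat.gcd k (p-1) := by
    rw [IsCyclic.card_powMonoidHom_ker, Nat.card_eq_fintype_card, ZMod.card_units, Nat.gcd_comm]
  -- lifting
  have lift : ∀ c : K, ∃ z : ℤ_[p], z ^ k = 1 ∧ PadicInt.toZMod z = ((c : (ZMod p)ˣ) : ZMod p) := by
    rintro ⟨c, hc⟩
    have hc1 : c ^ k = 1 := hc
    have hc2 : c ^ (p-1) = 1 := ZMod.units_pow_card_sub_one_eq_one p c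
    obtain ⟨a, ha⟩ := ZMod.ringHom_surjective (PadicInt.toZMod (p := p)) (c : ZMod p)
    set d := Nat.gcd k (p-1) with hd
    have hcd : c ^ d = 1 := by
      rw [← orderOf_dvd_iff_pow_eq_one] at hc1 hc2 ⊢
      exact Nat.dvd_gcd hc1 hc2
    have hd0 : 0 < d := Nat.gcd_pos_of_pos_left _ hk
    have hdp : ¬ p ∣ d := by
      intro h
      have h1 : d ∣ p - 1 := Nat.gcd_dvd_right _ _
      have h2 := Nat.le_of_dvd (by omega) (h.trans h1)
      omega
    have toz : ∀ z : ℤ_[p], PadicInt.toZMod z = 0 ↔ ‖z‖ < 1 := by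
      intro z
      rw [← RingHom.mem_ker, PadicInt.ker_toZMod, IsLocalRing.mem_maximalIdeal, PadicInt.mem_nonunits]
    have ha1 : ‖a ^ d - 1‖ < 1 := by
      rw [← toz, map_sub, map_pow, ha, map_one, ← Units.val_pow_eq_pow_val, hcd]; simp
    have hone : ∀ z : ℤ_[p], PadicInt.toZMod z ≠ 0 → ‖z‖ = 1 := by
      intro z hz
      rw [Ne, toz] at hz
      exact le_antisymm (PadicInt.norm_le_one z) (not_lt.mp hz)
    have hder : ‖(d : ℤ_[p]) * a ^ (d - 1)‖ = 1 := by
      apply hone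
      rw [map_mul, map_pow, ha, map_natCast]
      apply mul_ne_zero
      · rwa [Ne, ZMod.natCast_eq_zero_iff]
      · exact pow_ne_zero _ c.ne_zero
    let F : Polynomial ℤ_[p] := Polynomial.X ^ d - 1
    have hFa : ∀ z : ℤ_[p], F.aeval z = z ^ d - 1 := by intro z; simp [F]
    have hFd : ∀ z : ℤ_[p], F.derivative.aeval z = d * z ^ (d-1) := by
      intro z; simp [F, Polynomial.derivative_X_pow]
    obtain ⟨z, hz, hza, -⟩ := hensels_lemma (F := F) (a := a) (by rw [hFa, hFd, hder]; simpa using ha1)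
    rw [hFa] at hz
    rw [hFd, hder] at hza
    refine ⟨z, ?_, ?_⟩
    · have hz1 : z ^ d = 1 := by linear_combination hz
      obtain ⟨m, hm⟩ : d ∣ k := Nat.gcd_dvd_left _ _
      rw [hm, pow_mul, hz1, one_pow]
    · rw [← toz, map_sub, sub_eq_zero] at hza
      rw [hza, ha]
  choose L hL1 hL2 using lift
  let Φ : K → R := fun c => ⟨(L c : ℚ_[p]), by rw [← PadicInt.coe_pow, hL1]; simp⟩
  have hΦi : Function.Injective Φ := by
    intro c c' h
    have : L c = L c' := by
      have := congrArg Subtype.val h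
      exact Subtype.ext this
    apply Subtype.ext; apply Units.ext
    rw [← hL2, ← hL2, this]
  have hΦs : Function.Surjective Φ := by
    rintro ⟨ξ, hξ⟩
    have hn := root_norm hk hξ
    let z : ℤ_[p] := ⟨ξ, hn.le⟩
    have hz : z ^ k = 1 := by apply Subtype.ext; rw [PadicInt.coe_pow]; exact hξ
    have hzz : (PadicInt.toZMod z) ^ k = 1 := by rw [← map_pow, hz, map_one]
    let u : (ZMod p)ˣ := Units.ofPowEqOne _ k hzz (by omega)
    have hu : (u : ZMod p) = PadicInt.toZMod z := rfl
    let c : K := ⟨u, by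
      change u ^ k = 1
      apply Units.ext; rw [Units.val_pow_eq_pow_val, hu, hzz]; rfl⟩
    refine ⟨c, Subtype.ext ?_⟩
    by_contra hne
    have h1 := root_sep hp hk (Φ c).2 hξ hne
    have h2 : ‖L c - z‖ < 1 := by
      rw [← PadicInt.mem_nonunits, ← IsLocalRing.mem_maximalIdeal, ← PadicInt.ker_toZMod, RingHom.mem_ker,
        map_sub, hL2, sub_eq_zero]
      exact hu
    have h3 : ‖((L c : ℚ_[p]) - ξ)‖ < 1 := h2
    exact absurd h1 h3.ne
  have : Finite K := inferInstance
  let e : Fin (Nat.gcd k (p-1)) ≃ K := (finCongr hK.symm).trans (Finite.equivFin K).symm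
  refine ⟨fun i => (Φ (e i)).1, ?_, fun i => (Φ (e i)).2, ?_⟩
  · intro i j hij
    exact e.injective (hΦi (Subtype.ext hij))
  · intro ξ hξ
    obtain ⟨c, hc⟩ := hΦs ⟨ξ, hξ⟩
    refine ⟨e.symm c, ?_⟩
    simp [hc]

end

section
variable {p : ℕ} [Fact p.Prime]

theorem inv_le_norm_six (hp : 3 ≤ p) : (p : ℝ)⁻¹ ≤ ‖(6 : ℚ_[p])‖ := by
  have h := pow_le_norm2 hp 1
  have e : (6 : ℚ_[p]) = 2 * ((1 + 2 : ℕ) : ℚ_[p]) := by norm_num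
  rw [e, norm_mul, norm_two hp, one_mul]
  simpa using h

theorem inv_p_pos : 0 < (p : ℝ)⁻¹ := by
  have : 0 < p := (Fact.out : p.Prime).pos
  positivity

theorem norm_km (k : ℕ) (m : ℕ) : ‖(k : ℚ_[p]) - m‖ ≤ 1 := ult_sub_le (nat_le_one k) (nat_le_one m)

theorem norm_km1 (k : ℕ) : ‖(k : ℚ_[p]) - 1‖ ≤ 1 := by simpa using norm_km (p := p) k 1
theorem norm_km2 (k : ℕ) : ‖(k : ℚ_[p]) - 2‖ ≤ 1 := by simpa using norm_km (p := p) k 2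

theorem bracket_le (hp : 3 ≤ p) (q k : ℕ) (hqk : ‖(q : ℚ_[p])‖ < ‖(k : ℚ_[p])‖) :
    ‖1 - (q : ℚ_[p]) / 2 + ((k : ℚ_[p]) - 2) * (q : ℚ_[p]) ^ 2 / (6 * (k : ℚ_[p]))‖ ≤ 1 := by
  have hK : 0 < ‖(k : ℚ_[p])‖ := (norm_nonneg _).trans_lt hqk
  have hQρ : ‖(q : ℚ_[p])‖ ≤ (p:ℝ)⁻¹ := norm_le_inv (hqk.trans_le (nat_le_one k))
  have h6 := inv_le_norm_six hp
  have hρ := inv_p_pos (p := p)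
  apply ult_add_le
  · apply ult_sub_le (by simp)
    rw [norm_div, norm_two hp, div_one]; exact nat_le_one q
  · have h6p : 0 < ‖(6 : ℚ_[p])‖ := hρ.trans_le h6
    rw [norm_div, norm_mul, norm_mul, norm_pow, div_le_one (by positivity)]
    calc _ ≤ 1 * ‖(q : ℚ_[p])‖ ^ 2 := by gcongr; exact norm_km2 k
      _ = ‖(q : ℚ_[p])‖ * ‖(q : ℚ_[p])‖ := by ring
      _ ≤ _ := by gcongr; exact hQρ.trans h6

theorem X_near (hp : 3 ≤ p) (q k : ℕ) (hk : 1 ≤ k) (θ : ℚ_[p])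
    (hqk : ‖(q : ℚ_[p])‖ < ‖(k : ℚ_[p])‖) (y : ℚ_[p]) (hy : y ∈ XSet p q k θ) :
    ‖y - 1 + q‖ ≤ ‖θ - 1‖ := by
  obtain ⟨ξ, hξ, hd⟩ := hy
  have e : y - 1 + q = (y - xiCenter p q k θ ξ) + (xiCenter p q k θ ξ - 1 + q) := by ring
  rw [e]
  apply ult_add_le
  · refine hd.le.trans ?_
    rw [norm_mul]; exact mul_le_of_le_one_left (norm_nonneg _) (nat_le_one q)
  · unfold xiCenter
    split_ifs with h1
    · rw [show ∀ A B : ℚ_[p], 1 - (q : ℚ_[p]) + A * B * (θ - 1) - 1 + q = A * B * (θ - 1) by intros; ring,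
        norm_mul, norm_mul]
      refine mul_le_of_le_one_left (norm_nonneg _) ?_
      exact mul_le_one₀ (norm_km1 k) (norm_nonneg _) (bracket_le hp q k hqk)
    · rw [show ∀ A : ℚ_[p], 2 - (q : ℚ_[p]) - θ + A - 1 + q = A - (θ - 1) by intros; ring]
      apply ult_sub_le _ le_rfl
      rw [norm_div, root_sep hp hk (one_pow k) hξ (Ne.symm h1), div_one, norm_mul]
      exact mul_le_of_le_one_left (norm_nonneg _) (nat_le_one q)

/-- inverse branch in terms of the root parameter `s` -/
noncomputable def branch (q : ℕ) (θ ξ s : ℚ_[p]) : ℚ_[p] :=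
  2 - q - θ + (θ - 1) * (θ - 1 + q) / (θ - ξ * (1 + s))

theorem s_norm (hp : 3 ≤ p) (q k : ℕ) (θ : ℚ_[p]) 
    (hqk : ‖(q : ℚ_[p])‖ < ‖(k : ℚ_[p])‖) (hθq : ‖θ - 1‖ < ‖(q : ℚ_[p])‖ ^ 2)
    (y s : ℚ_[p]) (hy : ‖y - 1 + q‖ ≤ ‖θ - 1‖) (hs : ‖s‖ ≤ (p:ℝ)⁻¹) (hsy : (1 + s) ^ k = y) :
    ‖(k : ℚ_[p])‖ * ‖s‖ = ‖(q : ℚ_[p])‖ := by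
  have h := iso1 hp k s 0 hs (by simp)
  rw [hsy] at h
  simp only [add_zero, one_pow, sub_zero] at h
  rw [← h, show y - 1 = -(q - (y - 1 + q)) by ring, norm_neg]
  apply ult_sub_eq
  refine hy.trans_lt (hθq.trans_le ?_)
  rw [sq]; exact mul_le_of_le_one_left (norm_nonneg _) (nat_le_one q)

theorem D_norm_one (q k : ℕ) (hq : 1 ≤ q) (θ s : ℚ_[p]) 
    (hθq : ‖θ - 1‖ < ‖(q : ℚ_[p])‖ ^ 2) (hks : ‖(k : ℚ_[p])‖ * ‖s‖ = ‖(q : ℚ_[p])‖) :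
    ‖θ - 1 * (1 + s)‖ = ‖s‖ := by
  rw [show θ - 1 * (1 + s) = -(s - (θ - 1)) by ring, norm_neg]
  apply ult_sub_eq
  have h1 : ‖(q : ℚ_[p])‖ ≤ ‖s‖ := by
    rw [← hks]; exact mul_le_of_le_one_left (norm_nonneg _) (nat_le_one k)
  refine hθq.trans_le (le_trans ?_ h1)
  rw [sq]; exact mul_le_of_le_one_left (norm_nonneg _) (nat_le_one q)

theorem D_norm_ne (hp : 3 ≤ p) (q k : ℕ) (hk : 1 ≤ k) (θ s ξ : ℚ_[p]) 
    (hθq : ‖θ - 1‖ < ‖(q : ℚ_[p])‖ ^ 2) (hs : ‖s‖ ≤ (p:ℝ)⁻¹) (hξ : ξ ^ k = 1) (h1 : ξ ≠ 1) :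
    ‖θ - ξ * (1 + s)‖ = 1 := by
  have h2 := root_sep hp hk (one_pow k) hξ (Ne.symm h1)
  rw [show θ - ξ * (1 + s) = (1 - ξ) + ((θ - 1) - ξ * s) by ring]
  rw [ult_add_eq, h2]
  rw [h2]
  apply ult_sub_lt
  · refine hθq.trans_le (pow_le_one₀ (norm_nonneg _) (nat_le_one q))
  · rw [norm_mul, root_norm hk hξ, one_mul]; exact hs.trans_lt (inv_p_lt_one hp)

theorem D_norm_ge (hp : 3 ≤ p) (q k : ℕ) (hq : 1 ≤ q) (hk : 1 ≤ k) (θ s ξ : ℚ_[p]) 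
    (hθq : ‖θ - 1‖ < ‖(q : ℚ_[p])‖ ^ 2) (hks : ‖(k : ℚ_[p])‖ * ‖s‖ = ‖(q : ℚ_[p])‖)
    (hs : ‖s‖ ≤ (p:ℝ)⁻¹) (hξ : ξ ^ k = 1) : ‖s‖ ≤ ‖θ - ξ * (1 + s)‖ := by
  by_cases h1 : ξ = 1
  · rw [h1, D_norm_one q k hq θ s hθq hks]
  · rw [D_norm_ne hp q k hk θ s ξ hθq hs hξ h1]; exact hs.trans (inv_p_lt_one hp).le

theorem tq_norm (q : ℕ) (θ : ℚ_[p]) (hθq : ‖θ - 1‖ < ‖(q : ℚ_[p])‖ ^ 2) :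
    ‖θ - 1 + q‖ = ‖(q : ℚ_[p])‖ := by
  rw [add_comm]
  apply ult_add_eq
  refine hθq.trans_le ?_
  rw [sq]; exact mul_le_of_le_one_left (norm_nonneg _) (nat_le_one q)

theorem f_branch (q k : ℕ) (hq : 1 ≤ q) (θ ξ s y : ℚ_[p]) (hθ1 : θ ≠ 1)
    (hθq : ‖θ - 1‖ < ‖(q : ℚ_[p])‖ ^ 2) (hD : θ - ξ * (1 + s) ≠ 0)
    (hξ : ξ ^ k = 1) (hsy : (1 + s) ^ k = y) :
    pottsBethe p q k θ (branch q θ ξ s) = y := by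
  have hq0 : (q : ℚ_[p]) ≠ 0 := by exact_mod_cast (by omega : q ≠ 0)
  have hτ : θ - 1 ≠ 0 := sub_ne_zero.mpr hθ1
  have hτq : θ - 1 + q ≠ 0 := by
    rw [← norm_pos_iff, tq_norm q θ hθq]; exact norm_pos_iff.mpr hq0
  unfold pottsBethe
  have e1 : branch q θ ξ s + θ + q - 2 = (θ - 1) * (θ - 1 + q) / (θ - ξ * (1 + s)) := by
    unfold branch; ring
  have e2 : θ * branch q θ ξ s + q - 1 = ξ * (1 + s) * ((θ - 1) * (θ - 1 + q) / (θ - ξ * (1 + s))) := by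
    unfold branch
    field_simp
    ring
  rw [e1, e2, mul_div_assoc, div_self (div_ne_zero (mul_ne_zero hτ hτq) hD), mul_one, mul_pow, hξ, hsy, one_mul]

theorem branch_near_ne (hp : 3 ≤ p) (q k : ℕ) (hq : 1 ≤ q) (hk : 1 ≤ k) (θ ξ s : ℚ_[p]) (hθ1 : θ ≠ 1)
    (hθq : ‖θ - 1‖ < ‖(q : ℚ_[p])‖ ^ 2) (hq1 : ‖(q : ℚ_[p])‖ < 1)
    (hs : ‖s‖ ≤ (p:ℝ)⁻¹) (hξ : ξ ^ k = 1) (h1 : ξ ≠ 1) :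
    ‖branch q θ ξ s - xiCenter p q k θ ξ‖ < ‖(q : ℚ_[p]) * (θ - 1)‖ := by
  have hQ : 0 < ‖(q : ℚ_[p])‖ := norm_pos_iff.mpr (by exact_mod_cast (by omega : q ≠ 0))
  have ht : 0 < ‖θ - 1‖ := norm_pos_iff.mpr (sub_ne_zero.mpr hθ1)
  have hD := D_norm_ne hp q k hk θ s ξ hθq hs hξ h1
  have hD0 : θ - ξ * (1 + s) ≠ 0 := by rw [← norm_pos_iff, hD]; norm_num
  have h2 := root_sep hp hk (one_pow k) hξ (Ne.symm h1)
  have h20 : 1 - ξ ≠ 0 := by rw [← norm_pos_iff, h2]; norm_num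
  have e : branch q θ ξ s - xiCenter p q k θ ξ =
      (θ - 1) * ((θ - 1) * (1 - ξ) - q * ((θ - 1) - ξ * s)) / ((1 - ξ) * (θ - ξ * (1 + s))) := by
    unfold branch xiCenter
    rw [if_neg h1]
    field_simp
    ring
  rw [e, norm_div, norm_mul, norm_mul (1 - ξ), hD, h2, mul_one, div_one, mul_comm, norm_mul (q : ℚ_[p])]
  apply mul_lt_mul_of_pos_right _ ht
  apply ult_sub_lt
  · rw [norm_mul, h2, mul_one]
    refine hθq.trans ?_
    rw [sq]; exact mul_lt_of_lt_one_left hQ hq1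
  · rw [norm_mul]
    apply mul_lt_of_lt_one_right hQ
    apply ult_sub_lt
    · refine hθq.trans_le (pow_le_one₀ (norm_nonneg _) (nat_le_one q))
    · rw [norm_mul, root_norm hk hξ, one_mul]; exact hs.trans_lt (inv_p_lt_one hp)

theorem branch_near_one (hp : 3 ≤ p) (q k : ℕ) (hq : 1 ≤ q) (θ s y : ℚ_[p]) (hθ1 : θ ≠ 1)
    (hqk : ‖(q : ℚ_[p])‖ < ‖(k : ℚ_[p])‖) (hθq : ‖θ - 1‖ < ‖(q : ℚ_[p])‖ ^ 2)
    (hy : ‖y - 1 + q‖ ≤ ‖θ - 1‖) (hs : ‖s‖ ≤ (p:ℝ)⁻¹) (hsy : (1 + s) ^ k = y) :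
    ‖branch q θ 1 s - xiCenter p q k θ 1‖ < ‖(q : ℚ_[p]) * (θ - 1)‖ := by
  have hks := s_norm hp q k θ hqk hθq y s hy hs hsy
  have hQ : 0 < ‖(q : ℚ_[p])‖ := norm_pos_iff.mpr (by exact_mod_cast (by omega : q ≠ 0))
  have ht : 0 < ‖θ - 1‖ := norm_pos_iff.mpr (sub_ne_zero.mpr hθ1)
  have hK : 0 < ‖(k : ℚ_[p])‖ := (norm_nonneg _).trans_lt hqk
  have hK1 := nat_le_one (p := p) k
  have hρ1 := inv_p_lt_one hp
  have hρ := inv_p_pos (p := p)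
  have h6 := inv_le_norm_six hp
  have hk0 : (k : ℚ_[p]) ≠ 0 := norm_pos_iff.mp hK
  have hS : 0 < ‖s‖ := by
    by_contra h
    have : ‖s‖ = 0 := le_antisymm (not_lt.mp h) (norm_nonneg _)
    rw [this, mul_zero] at hks; exact hQ.ne hks
  have hqs : ‖(q : ℚ_[p])‖ ≤ ‖s‖ := by
    rw [← hks]; exact mul_le_of_le_one_left (norm_nonneg _) hK1
  have hD := D_norm_one q k hq θ s hθq hks
  have hD0 : θ - 1 * (1 + s) ≠ 0 := by rw [← norm_pos_iff, hD]; exact hS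
  have hτC : ‖θ - 1‖ < ‖(q : ℚ_[p])‖ * ‖s‖ := by
    refine hθq.trans_le ?_
    rw [sq]; gcongr
  -- the center
  obtain ⟨A, hA⟩ : ∃ A : ℚ_[p], A = 1 + ((k : ℚ_[p]) - 1) *
      (1 - (q : ℚ_[p]) / 2 + ((k : ℚ_[p]) - 2) * (q : ℚ_[p]) ^ 2 / (6 * (k : ℚ_[p]))) := ⟨_, rfl⟩
  have hA1 : ‖A‖ ≤ 1 := by
    rw [hA]
    apply ult_add_le (by simp)
    rw [norm_mul]
    exact mul_le_one₀ (norm_km1 k) (norm_nonneg _) (bracket_le hp q k hqk)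
  have e : branch q θ 1 s - xiCenter p q k θ 1 =
      (θ - 1) * (((θ - 1) - A * (θ - 1)) + (q + A * s)) / (θ - 1 * (1 + s)) := by
    have ec : xiCenter p q k θ 1 = 2 - q - θ + A * (θ - 1) := by
      unfold xiCenter; rw [if_pos rfl, hA]; ring
    rw [ec]; unfold branch
    rw [eq_div_iff hD0, add_sub_add_left_eq_sub, sub_mul, div_mul_cancel₀ _ hD0]
    ring
  rw [e, norm_div, hD, div_lt_iff₀ hS, norm_mul, norm_mul (q : ℚ_[p])]
  suffices h : ‖((θ - 1) - A * (θ - 1)) + (q + A * s)‖ < ‖(q : ℚ_[p])‖ * ‖s‖ by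
    calc _ < ‖θ - 1‖ * (‖(q : ℚ_[p])‖ * ‖s‖) := by gcongr
      _ = _ := by ring
  apply ult_add_lt
  · apply ult_sub_lt hτC
    rw [norm_mul]
    exact (mul_le_of_le_one_left (norm_nonneg _) hA1).trans_lt hτC
  have k1 := key1 hp k s 0 hs (by simp)
  simp only [add_zero, one_pow, sub_zero] at k1
  rw [hsy, hks] at k1
  have k2 := key2 hp k s hs
  rw [hsy] at k2
  have hl : ‖(k : ℚ_[p]) * s + q‖ < ‖(q : ℚ_[p])‖ := by
    rw [show (k : ℚ_[p]) * s + q = (y - 1 + q) - (y - 1 - k * s) by ring]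
    apply ult_sub_lt
    · refine hy.trans_lt (hθq.trans_le ?_)
      rw [sq]; exact mul_le_of_le_one_left (norm_nonneg _) (nat_le_one q)
    · exact k1.trans_lt (mul_lt_of_lt_one_left hQ hρ1)
  have hl2 : ‖(k : ℚ_[p]) * s - q‖ ≤ ‖(q : ℚ_[p])‖ := by
    apply ult_sub_le _ le_rfl
    rw [norm_mul, hks]
  have hss : ‖s‖ < 1 := hs.trans_lt hρ1
  have h60 : (6 : ℚ_[p]) ≠ 0 := by norm_num
  have e2 : (q : ℚ_[p]) + A * s = (y - 1 + q)
      - (y - (1 + k * s + k * (k - 1) / 2 * s ^ 2 + k * (k - 1) * (k - 2) / 6 * s ^ 3))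
      - ((k - 1) / 2 * s * (k * s + q)
        + (k - 1) * (k - 2) / (6 * k) * s * ((k * s + q) * (k * s - q))) := by
    rw [hA]
    field_simp
    ring
  rw [e2]
  apply ult_sub_lt
  · apply ult_sub_lt (hy.trans_lt hτC)
    refine k2.trans_lt ?_
    rw [show (p:ℝ)⁻¹ * (‖(k : ℚ_[p])‖ * ‖s‖ ^ 2) = (p:ℝ)⁻¹ * ((‖(k : ℚ_[p])‖ * ‖s‖) * ‖s‖) by ring, hks]
    exact mul_lt_of_lt_one_left (by positivity) hρ1
  · apply ult_add_lt
    · rw [norm_mul, norm_mul, norm_div, norm_two hp, div_one]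
      calc _ ≤ 1 * ‖s‖ * ‖(k : ℚ_[p]) * s + q‖ := by gcongr; exact norm_km1 k
        _ < 1 * ‖s‖ * ‖(q : ℚ_[p])‖ := by gcongr
        _ = _ := by ring
    · rw [norm_mul, norm_mul, norm_mul (_ + _), norm_div, norm_mul, norm_mul 6]
      have hl' : ‖(k : ℚ_[p]) * s + q‖ ≤ (p:ℝ)⁻¹ * ‖(q : ℚ_[p])‖ := by
        have : ‖((k : ℚ_[p]) * s + q) / q‖ ≤ (p:ℝ)⁻¹ := by
          apply norm_le_inv; rw [norm_div, div_lt_one hQ]; exact hl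
        rwa [norm_div, div_le_iff₀ hQ] at this
      calc _ ≤ 1 * 1 / ((p:ℝ)⁻¹ * ‖(k : ℚ_[p])‖) * ‖s‖ * (((p:ℝ)⁻¹ * ‖(q : ℚ_[p])‖) * ‖(q : ℚ_[p])‖) := by
            gcongr
            · exact norm_km1 k
            · exact norm_km2 k
        _ = ‖s‖ * ‖(q : ℚ_[p])‖ * (‖(q : ℚ_[p])‖ / ‖(k : ℚ_[p])‖) := by field_simp
        _ < ‖s‖ * ‖(q : ℚ_[p])‖ * 1 := by
            gcongr; rwa [div_lt_one hK]
        _ = _ := by ring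

theorem center_sep (hp : 3 ≤ p) (q k : ℕ) (hk : 1 ≤ k) (θ ξ η : ℚ_[p]) 
    (hqk : ‖(q : ℚ_[p])‖ < ‖(k : ℚ_[p])‖) (hξ : ξ ^ k = 1) (hη : η ^ k = 1) (hne : ξ ≠ η)
    (hη1 : η ≠ 1) :
    ‖(q : ℚ_[p]) * (θ - 1)‖ ≤ ‖xiCenter p q k θ ξ - xiCenter p q k θ η‖ := by
  have hK : 0 < ‖(k : ℚ_[p])‖ := (norm_nonneg _).trans_lt hqk
  have hk0 : (k : ℚ_[p]) ≠ 0 := norm_pos_iff.mp hK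
  have h2 := root_sep hp hk (one_pow k) hη (Ne.symm hη1)
  have h20 : 1 - η ≠ 0 := by rw [← norm_pos_iff, h2]; norm_num
  by_cases h1 : ξ = 1
  · subst h1
    have e : xiCenter p q k θ 1 - xiCenter p q k θ η =
      (k + (((k : ℚ_[p]) - 1) * ((k - 2) * q ^ 2 / (6 * k)) - (k - 1) * q / 2 - q / (1 - η))) * (θ - 1) := by
      unfold xiCenter; rw [if_pos rfl, if_neg hη1]; ring
    rw [e, norm_mul, norm_mul]
    gcongr
    have hQρ : ‖(q : ℚ_[p])‖ ≤ (p:ℝ)⁻¹ := norm_le_inv (hqk.trans_le (nat_le_one k))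
    have h6 := inv_le_norm_six hp
    have hρ := inv_p_pos (p := p)
    have : ‖((k : ℚ_[p]) - 1) * ((k - 2) * q ^ 2 / (6 * k)) - (k - 1) * q / 2 - q / (1 - η)‖ ≤ ‖(q : ℚ_[p])‖ := by
      apply ult_sub_le
      · apply ult_sub_le
        · rw [norm_mul, norm_div, norm_mul, norm_mul, norm_pow]
          calc _ ≤ 1 * (1 * ‖(q : ℚ_[p])‖ ^ 2 / ((p:ℝ)⁻¹ * ‖(k : ℚ_[p])‖)) := by
                gcongr
                · exact norm_km1 k
                · exact norm_km2 k
            _ = ‖(q : ℚ_[p])‖ * ((‖(q : ℚ_[p])‖ / ‖(k : ℚ_[p])‖) / (p:ℝ)⁻¹) := by field_simp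
            _ ≤ ‖(q : ℚ_[p])‖ * 1 := by
                gcongr
                rw [div_le_one hρ, ← norm_div]
                apply norm_le_inv; rwa [norm_div, div_lt_one hK]
            _ = _ := by ring
        · rw [norm_div, norm_two hp, div_one, norm_mul]
          exact mul_le_of_le_one_left (norm_nonneg _) (norm_km1 k)
      · rw [norm_div, h2, div_one]
    rw [ult_add_eq (this.trans_lt hqk)]; exact hqk.le
  · have h3 := root_sep hp hk (one_pow k) hξ (Ne.symm h1)
    have h30 : 1 - ξ ≠ 0 := by rw [← norm_pos_iff, h3]; norm_num
    have e : xiCenter p q k θ ξ - xiCenter p q k θ η = q * (θ - 1) * (ξ - η) / ((1 - ξ) * (1 - η)) := by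
      unfold xiCenter; rw [if_neg h1, if_neg hη1]; field_simp; ring
    rw [e, norm_div, norm_mul _ (ξ - η), norm_mul (1 - ξ), h2, h3, root_sep hp hk hξ hη hne]
    simp

end

theorem stmt11 (p : ℕ) [Fact p.Prime] (hp : 3 ≤ p) (q k : ℕ) (hq : 1 ≤ q) (hk : 1 ≤ k)
    (θ : ℚ_[p]) (hθ1 : θ ≠ 1) (hqk : ‖(q : ℚ_[p])‖ < ‖(k : ℚ_[p])‖)
    (hθq : ‖θ - 1‖ < ‖(q : ℚ_[p])‖ ^ 2) (hκ : 2 ≤ Nat.gcd k (p - 1)) :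
    Set.MapsTo (pottsBethe p q k θ) (JSet p q k θ) (JSet p q k θ) ∧
    ∃ e : (JSet p q k θ) ≃ₜ (ℕ → Fin (Nat.gcd k (p - 1))),
      ∀ (x : ℚ_[p]) (hx : x ∈ JSet p q k θ) (hfx : pottsBethe p q k θ x ∈ JSet p q k θ),
        e ⟨pottsBethe p q k θ x, hfx⟩ = fun n => e ⟨x, hx⟩ (n + 1) := by
  obtain ⟨r, hri, hr1, hrs⟩ := card_roots hp hk
  have hQ : 0 < ‖(q : ℚ_[p])‖ := norm_pos_iff.mpr (by exact_mod_cast (by omega : q ≠ 0))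
  have ht : 0 < ‖θ - 1‖ := norm_pos_iff.mpr (sub_ne_zero.mpr hθ1)
  have hK : 0 < ‖(k : ℚ_[p])‖ := (norm_nonneg _).trans_lt hqk
  have hK1 := nat_le_one (p := p) k
  have hQ1 : ‖(q : ℚ_[p])‖ < 1 := hqk.trans_le hK1
  have hR : 0 < ‖(q : ℚ_[p]) * (θ - 1)‖ := by rw [norm_mul]; positivity
  have hXn := X_near hp q k hk θ hqk
  have hroot : ∀ y ∈ XSet p q k θ, ∃ s : ℚ_[p], ‖s‖ ≤ (p : ℝ)⁻¹ ∧ (1 + s) ^ k = y := by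
    intro y hy
    apply exists_root hp
    have h1 := hXn y hy
    rw [show y - 1 = (y - 1 + q) - q by ring]
    apply ult_sub_lt _ hqk
    refine (h1.trans_lt hθq).trans (lt_of_le_of_lt ?_ hqk)
    rw [sq]; exact mul_le_of_le_one_left (norm_nonneg _) hQ1.le
  let σ : ℚ_[p] → ℚ_[p] := fun y => if h : y ∈ XSet p q k θ then (hroot y h).choose else 0
  have hσ : ∀ y ∈ XSet p q k θ, ‖σ y‖ ≤ (p:ℝ)⁻¹ ∧ (1 + σ y) ^ k = y := by
    intro y hy
    simp only [σ, dif_pos hy]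
    exact (hroot y hy).choose_spec
  have hks : ∀ y ∈ XSet p q k θ, ‖(k : ℚ_[p])‖ * ‖σ y‖ = ‖(q : ℚ_[p])‖ := fun y hy =>
    s_norm hp q k θ hqk hθq y _ (hXn y hy) (hσ y hy).1 (hσ y hy).2
  have hσpos : ∀ y ∈ XSet p q k θ, 0 < ‖σ y‖ := by
    intro y hy
    by_contra h
    have h0 : ‖σ y‖ = 0 := le_antisymm (not_lt.mp h) (norm_nonneg _)
    have := hks y hy
    rw [h0, mul_zero] at this; exact hQ.ne this
  have hDge : ∀ y ∈ XSet p q k θ, ∀ i, ‖σ y‖ ≤ ‖θ - r i * (1 + σ y)‖ := fun y hy i =>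
    D_norm_ge hp q k hq hk θ _ _ hθq (hks y hy) (hσ y hy).1 (hr1 i)
  have hD0 : ∀ y ∈ XSet p q k θ, ∀ i, θ - r i * (1 + σ y) ≠ 0 := fun y hy i =>
    norm_pos_iff.mp ((hσpos y hy).trans_le (hDge y hy i))
  let V : Fin (Nat.gcd k (p - 1)) → Set ℚ_[p] := fun i =>
    Metric.ball (xiCenter p q k θ (r i)) ‖(q : ℚ_[p]) * (θ - 1)‖
  let φ : Fin (Nat.gcd k (p - 1)) → ℚ_[p] → ℚ_[p] := fun i y => branch q θ (r i) (σ y)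
  have hφV : ∀ i, ∀ y ∈ XSet p q k θ, φ i y ∈ V i := by
    intro i y hy
    simp only [V, φ, Metric.mem_ball, dist_eq_norm]
    by_cases h1 : r i = 1
    · rw [h1]
      exact branch_near_one hp q k hq θ _ y hθ1 hqk hθq (hXn y hy) (hσ y hy).1 (hσ y hy).2
    · exact branch_near_ne hp q k hq hk θ _ _ hθ1 hθq hQ1 (hσ y hy).1 (hr1 i) h1
  have hXV : XSet p q k θ = ⋃ i, V i := by
    ext x
    simp only [XSet, V, Set.mem_ofPred_eq, Set.mem_iUnion, Metric.mem_ball, dist_eq_norm]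
    constructor
    · rintro ⟨ξ, hξ, h⟩
      obtain ⟨i, rfl⟩ := hrs ξ hξ
      exact ⟨i, h⟩
    · rintro ⟨i, h⟩
      exact ⟨r i, hr1 i, h⟩
  have hVX : ∀ i, V i ⊆ XSet p q k θ := fun i => by rw [hXV]; exact Set.subset_iUnion V i
  refine abstract_coding (XSet p q k θ) ?_ ?_ ?_ (pottsBethe p q k θ) V ?_ φ
    (fun i y hy => hVX i (hφV i y hy)) hφV ?_ ?_ ⟨(p:ℝ)⁻¹, by positivity⟩ ?_ ?_ (JSet p q k θ) rfl
  · rw [hXV]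
    exact (isClosed_iUnion_of_finite fun i => IsUltrametricDist.isClosed_ball _ _).isComplete
  · rw [hXV]
    exact (Bornology.isBounded_iUnion).mpr fun i => Metric.isBounded_ball
  · exact ⟨_, hVX ⟨0, by omega⟩ (Metric.mem_ball_self hR)⟩
  · intro i j x hi hj
    by_contra hij
    have hne : r i ≠ r j := fun h => hij (hri h)
    have hsep : ‖(q : ℚ_[p]) * (θ - 1)‖ ≤ ‖xiCenter p q k θ (r i) - xiCenter p q k θ (r j)‖ := by
      by_cases h1 : r j = 1
      · rw [norm_sub_rev]
        exact center_sep hp q k hk θ _ _ hqk (hr1 j) (hr1 i) hne.symm (by rw [← h1]; exact hne)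
      · exact center_sep hp q k hk θ _ _ hqk (hr1 i) (hr1 j) hne h1
    simp only [V, Metric.mem_ball, dist_eq_norm] at hi hj
    have := ult_sub_lt hj hi
    rw [sub_sub_sub_cancel_left] at this
    exact absurd hsep (not_le.mpr this)
  · intro i y hy
    exact f_branch q k hq θ _ _ y hθ1 hθq (hD0 y hy i) (hr1 i) (hσ y hy).2
  · intro x hx
    obtain ⟨hs1, hs2⟩ := hσ _ hx
    have hn1 : ‖1 + σ (pottsBethe p q k θ x)‖ = 1 := by
      rw [ult_add_eq, norm_one]
      rw [norm_one]; exact hs1.trans_lt (inv_p_lt_one hp)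
    have hne : 1 + σ (pottsBethe p q k θ x) ≠ 0 := norm_pos_iff.mp (by rw [hn1]; norm_num)
    obtain ⟨g, hg⟩ : ∃ g, g = (θ * x + (q : ℚ_[p]) - 1) / (x + θ + (q : ℚ_[p]) - 2) := ⟨_, rfl⟩
    have hgk : g ^ k = (1 + σ (pottsBethe p q k θ x)) ^ k := by
      rw [hs2, hg]; rfl
    obtain ⟨i, hi⟩ := hrs (g / (1 + σ (pottsBethe p q k θ x))) (by
      rw [div_pow, hgk, div_self (pow_ne_zero _ hne)])
    refine ⟨i, ?_⟩
    have hDD := hD0 _ hx i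
    have hgi : r i * (1 + σ (pottsBethe p q k θ x)) = g := by rw [hi]; field_simp
    have hu : x + θ + (q : ℚ_[p]) - 2 ≠ 0 := by
      intro h0
      rw [h0, div_zero] at hg
      rw [hg, zero_pow (by omega)] at hgk
      exact pow_ne_zero k hne hgk.symm
    simp only [φ, branch]
    rw [hgi] at hDD ⊢
    have hg' : g * (x + θ + (q : ℚ_[p]) - 2) = θ * x + (q : ℚ_[p]) - 1 := by
      rw [hg]; field_simp
    rw [← sub_eq_iff_eq_add', eq_div_iff hDD]
    linear_combination -hg'
  · exact inv_p_lt_one hp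
  · intro i y hy y' hy'
    rw [dist_eq_norm, dist_eq_norm]
    have h1 := hDge y hy i
    have h2 := hDge y' hy' i
    have hd1 := hD0 y hy i
    have hd2 := hD0 y' hy' i
    have hS := hσpos y hy
    have hS' := hσpos y' hy'
    have hiso := iso1 hp k (σ y) (σ y') (hσ y hy).1 (hσ y' hy').1
    rw [(hσ y hy).2, (hσ y' hy').2] at hiso
    have e : φ i y - φ i y' = (θ - 1) * (θ - 1 + q) * r i * (σ y - σ y') /
        ((θ - r i * (1 + σ y)) * (θ - r i * (1 + σ y'))) := by
      simp only [φ, branch]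
      field_simp
      ring
    rw [e, norm_div, norm_mul, norm_mul, norm_mul, norm_mul, tq_norm q θ hθq, root_norm hk (hr1 i)]
    change _ ≤ (p:ℝ)⁻¹ * _
    rw [hiso]
    have e1 : ‖σ y‖ = ‖(q : ℚ_[p])‖ / ‖(k : ℚ_[p])‖ := by rw [← hks y hy]; field_simp
    have e2 : ‖σ y'‖ = ‖(q : ℚ_[p])‖ / ‖(k : ℚ_[p])‖ := by rw [← hks y' hy']; field_simp
    calc _ ≤ ‖θ - 1‖ * ‖(q : ℚ_[p])‖ * 1 * ‖σ y - σ y'‖ / (‖σ y‖ * ‖σ y'‖) := by gcongr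
      _ = (‖θ - 1‖ / ‖(q : ℚ_[p])‖) * ‖(k : ℚ_[p])‖ * (‖(k : ℚ_[p])‖ * ‖σ y - σ y'‖) := by
          rw [e1, e2]; field_simp
      _ ≤ (p:ℝ)⁻¹ * 1 * (‖(k : ℚ_[p])‖ * ‖σ y - σ y'‖) := by
          gcongr
          rw [div_le_iff₀ hQ]
          refine hθq.le.trans ?_
          rw [sq]; gcongr; exact norm_le_inv hQ1
      _ = _ := by ring
end
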